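/- If G is a 5-regular (finite simple) graph with girth 3 (i.e., G contains a triangle), then G has a strong edge-coloring that uses at most 37 colors; that is, χ'_s(G) ≤ 37. -/

import Mathlib

open SimpleGraph

/-- Two edges (given as elements of `Sym2 V`) are at distance at most two in `G`:
they share an endpoint, or some endpoint of one is adjacent to some endpoint of the other. -/
def EdgesNear {V : Type*} (G : SimpleGraph V) (e f : Sym2 V) : Prop :=
  (∃ x, x ∈ e ∧ x ∈ f) ∨ (∃ x y, x ∈ e ∧ y ∈ f ∧ G.Adj x y)

/-- A strong edge-coloring of `G` with colors in `Fin k`: any two distinct edges at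
distance at most two receive different colors. -/
def IsStrongEdgeColoring {V : Type*} (G : SimpleGraph V) {k : ℕ}
    (c : G.edgeSet → Fin k) : Prop :=
  ∀ e f : G.edgeSet, e ≠ f → EdgesNear G (e : Sym2 V) (f : Sym2 V) → c e ≠ c f

namespace StrongColoring

section

open Finset Classical

variable {V : Type*} {G : SimpleGraph V}

/-- `c` restricted to the edges in `S` is a strong edge-coloring. -/
def ProperOn (G : SimpleGraph V) (c : Sym2 V → Fin 37) (S : Finset (Sym2 V)) : Prop :=
  ∀ e ∈ S, ∀ f ∈ S, e ∈ G.edgeSet → f ∈ G.edgeSet → e ≠ f → EdgesNear G e f → c e ≠ c f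

lemma edgesNear_mk {a b c d : V} : EdgesNear G s(a, b) s(c, d) ↔
    ((a = c ∨ a = d) ∨ (b = c ∨ b = d)) ∨
      ((G.Adj a c ∨ G.Adj a d) ∨ (G.Adj b c ∨ G.Adj b d)) := by
  simp only [EdgesNear, Sym2.mem_iff]
  constructor
  · rintro (⟨x, rfl | rfl, rfl | rfl⟩ | ⟨x, y, rfl | rfl, rfl | rfl, h⟩) <;> simp_all
  · rintro (((rfl | rfl) | (rfl | rfl)) | ((h | h) | (h | h)))
    · exact Or.inl ⟨a, by simp⟩
    · exact Or.inl ⟨a, by simp⟩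
    · exact Or.inl ⟨b, by simp⟩
    · exact Or.inl ⟨b, by simp⟩
    · exact Or.inr ⟨a, c, by simp [h]⟩
    · exact Or.inr ⟨a, d, by simp [h]⟩
    · exact Or.inr ⟨b, c, by simp [h]⟩
    · exact Or.inr ⟨b, d, by simp [h]⟩

lemma edgesNear_symm {e f : Sym2 V} (h : EdgesNear G e f) : EdgesNear G f e := by
  rcases h with ⟨x, h1, h2⟩ | ⟨x, y, h1, h2, h3⟩
  · exact Or.inl ⟨x, h2, h1⟩
  · exact Or.inr ⟨y, x, h2, h1, h3.symm⟩

lemma ProperOn.mono {c : Sym2 V → Fin 37} {S S' : Finset (Sym2 V)} (h : ProperOn G c S)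
    (hS : ∀ e ∈ S', e ∈ G.edgeSet → e ∈ S) : ProperOn G c S' :=
  fun e he f hf he' hf' => h e (hS e he he') f (hS f hf hf') he' hf'

lemma exists_notMem_of_card_le {s : Finset (Fin 37)} (h : s.card ≤ 36) : ∃ k, k ∉ s := by
  by_contra! hk
  have : s = univ := eq_univ_iff_forall.2 hk
  simp [this] at h

lemma card_sdiff_le_of_subset {N W : Finset (Sym2 V)} {n m : ℕ} (hW : W ⊆ N)
    (hN : N.card ≤ n + m) (hm : m ≤ W.card) : (N \ W).card ≤ n := by
  rw [card_sdiff_of_subset hW]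
  omega

/-- A set `R` of edges whose colors all reappear in `N \ R` does not add colors to `N`. -/
lemma card_image_add_card_le {N R : Finset (Sym2 V)} {c : Sym2 V → Fin 37} (hR : R ⊆ N)
    (h : ∀ r ∈ R, ∃ s ∈ N, s ∉ R ∧ c s = c r) : (N.image c).card + R.card ≤ N.card := by
  have h1 : N.image c ⊆ (N \ R).image c := by
    intro k hk
    obtain ⟨e, he, rfl⟩ := mem_image.1 hk
    by_cases heR : e ∈ R
    · obtain ⟨s, hs, hsR, hcs⟩ := h e heR
      exact hcs ▸ mem_image_of_mem _ (mem_sdiff.2 ⟨hs, hsR⟩)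
    · exact mem_image_of_mem _ (mem_sdiff.2 ⟨he, heR⟩)
  have h2 := (card_le_card h1).trans card_image_le
  rw [card_sdiff_of_subset hR] at h2
  have := card_le_card hR
  omega

/-- `w, x, y, z` is a four-cycle of `G`. -/
structure FourCycle (G : SimpleGraph V) (w x y z : V) : Prop where
  wx : G.Adj w x
  xy : G.Adj x y
  yz : G.Adj y z
  zw : G.Adj z w
  wy : w ≠ y
  xz : x ≠ z

/-- The edges of the four-cycle `w, x, y, z`. -/
noncomputable def cyc (w x y z : V) : Finset (Sym2 V) := {s(w, x), s(x, y), s(y, z), s(z, w)}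

namespace FourCycle

variable {w x y z : V}

lemma card_cyc (h : FourCycle G w x y z) : (cyc w x y z).card = 4 := by
  have h1 := h.wx.ne
  have h2 := h.xy.ne
  have h3 := h.yz.ne
  have h4 := h.zw.ne
  have h5 := h.wy
  have h6 := h.xz
  rw [cyc, card_eq_succ]
  refine ⟨s(w, x), {s(x, y), s(y, z), s(z, w)}, by grind [Sym2.eq_iff], rfl, ?_⟩
  rw [card_eq_three]
  exact ⟨_, _, _, by grind [Sym2.eq_iff], by grind [Sym2.eq_iff], by grind [Sym2.eq_iff], rfl⟩

lemma cyc_subset_edgeSet (h : FourCycle G w x y z) {f : Sym2 V} (hf : f ∈ cyc w x y z) :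
    f ∈ G.edgeSet := by
  simp only [cyc, mem_insert, mem_singleton] at hf
  rcases hf with rfl | rfl | rfl | rfl
  exacts [h.wx, h.xy, h.yz, h.zw]

lemma edgesNear (h : FourCycle G w x y z) {v : V} (hv : v ∈ ({w, x, y, z} : Finset V))
    {e f : Sym2 V} (hve : v ∈ e) (hf : f ∈ cyc w x y z) : EdgesNear G e f := by
  obtain ⟨h1, h2, h3, h4, -, -⟩ := h
  obtain ⟨a, rfl⟩ := Sym2.mem_iff_exists.1 hve
  simp only [cyc, mem_insert, mem_singleton] at hv hf
  have h1' := h1.symm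
  have h2' := h2.symm
  have h3' := h3.symm
  have h4' := h4.symm
  rcases hv with rfl | rfl | rfl | rfl <;> rcases hf with rfl | rfl | rfl | rfl <;>
    simp [edgesNear_mk, *]

lemma exists_mem_of_mem_cyc {f : Sym2 V} (hf : f ∈ cyc w x y z) :
    ∃ v ∈ ({w, x, y, z} : Finset V), v ∈ f := by
  simp only [cyc, mem_insert, mem_singleton] at hf
  rcases hf with rfl | rfl | rfl | rfl
  exacts [⟨w, by simp⟩, ⟨x, by simp⟩, ⟨y, by simp⟩, ⟨z, by simp⟩]

end FourCycle

lemma not_edgesNear_of_not_adj {x z p r : V} (hxp : G.Adj x p) (hzr : G.Adj z r) (hxz : x ≠ z)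
    (hxz' : ¬ G.Adj x z) (hpr : ¬ G.Adj p r) (hpz : ¬ G.Adj p z) (hrx : ¬ G.Adj r x) :
    ¬ EdgesNear G s(x, p) s(z, r) := by
  rw [edgesNear_mk]
  have h1 := hzr.symm
  have h2 : ¬ G.Adj x r := fun h => hrx h.symm
  grind

variable [Fintype V]

/-- The finite set of neighbours of a vertex. -/
noncomputable def nbrs (G : SimpleGraph V) (v : V) : Finset V := univ.filter (G.Adj v)

/-- The finite set of edges incident with a vertex. -/
noncomputable def inc (G : SimpleGraph V) (v : V) : Finset (Sym2 V) :=
  (nbrs G v).image (fun u => s(v, u))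

/-- The edges different from `e` at distance at most two from `e`. -/
noncomputable def near (G : SimpleGraph V) (e : Sym2 V) : Finset (Sym2 V) :=
  univ.filter (fun f => f ∈ G.edgeSet ∧ f ≠ e ∧ EdgesNear G e f)

@[simp] lemma mem_nbrs {u v : V} : u ∈ nbrs G v ↔ G.Adj v u := by simp [nbrs]

lemma mem_inc {e : Sym2 V} {v : V} : e ∈ inc G v ↔ e ∈ G.edgeSet ∧ v ∈ e := by
  induction e with | _ a b
  simp only [inc, mem_image, mem_nbrs, SimpleGraph.mem_edgeSet, Sym2.mem_iff, Sym2.eq_iff]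
  constructor
  · rintro ⟨u, hu, ⟨rfl, rfl⟩ | ⟨rfl, rfl⟩⟩
    · exact ⟨hu, Or.inl rfl⟩
    · exact ⟨hu.symm, Or.inr rfl⟩
  · rintro ⟨h, rfl | rfl⟩
    · exact ⟨b, h, Or.inl ⟨rfl, rfl⟩⟩
    · exact ⟨a, h.symm, Or.inr ⟨rfl, rfl⟩⟩

lemma card_inc (v : V) : (inc G v).card = (nbrs G v).card := by
  apply card_image_of_injective
  exact fun a b h => Sym2.congr_right.1 h

lemma mem_near {e f : Sym2 V} :
    f ∈ near G e ↔ f ∈ G.edgeSet ∧ f ≠ e ∧ EdgesNear G e f := by simp [near]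

lemma ProperOn.update {c : Sym2 V → Fin 37} {S : Finset (Sym2 V)} (h : ProperOn G c S)
    {e : Sym2 V} (he : e ∉ S) {k : Fin 37} (hk : k ∉ (near G e ∩ S).image c) :
    ProperOn G (Function.update c e k) (insert e S) := by
  have key : ∀ f ∈ S, f ∈ G.edgeSet → EdgesNear G e f → k ≠ c f := by
    rintro f hf hf' hn rfl
    exact hk (mem_image_of_mem _ (mem_inter.2 ⟨mem_near.2 ⟨hf', fun h => he (h ▸ hf), hn⟩, hf⟩))
  intro f hf g hg hf' hg' hfg hn
  rcases mem_insert.1 hf with rfl | hfS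
  · rcases mem_insert.1 hg with rfl | hgS
    · exact absurd rfl hfg
    · rw [Function.update_self, Function.update_of_ne hfg.symm]
      exact key g hgS hg' hn
  · have hfe : f ≠ e := fun h => he (h ▸ hfS)
    rcases mem_insert.1 hg with rfl | hgS
    · rw [Function.update_self, Function.update_of_ne hfg]
      exact (key f hfS hf' (edgesNear_symm hn)).symm
    · rw [Function.update_of_ne hfe, Function.update_of_ne fun h : g = e => he (h ▸ hgS)]
      exact h f hfS g hgS hf' hg' hfg hn

/-- Greedy extension of a partial coloring to `T`, while the edges of `W` stay uncolored. -/
lemma ProperOn.greedy {c : Sym2 V → Fin 37} {S : Finset (Sym2 V)} (h : ProperOn G c S)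
    {W : Finset (Sym2 V)} (T : Finset (Sym2 V)) (hSW : Disjoint S W) (hTW : Disjoint T W)
    (hb : ∀ e ∈ T, ∀ c' : Sym2 V → Fin 37, (∀ f ∈ S, c' f = c f) →
      ((near G e \ W).image c').card ≤ 36) :
    ∃ c' : Sym2 V → Fin 37, (∀ f ∈ S, c' f = c f) ∧ ProperOn G c' (S ∪ T) := by
  induction T using Finset.induction_on with
  | empty => exact ⟨c, fun _ _ => rfl, by simpa using h⟩
  | insert e T heT ih =>
    obtain ⟨c₁, hc₁, hp⟩ := ih (hTW.mono_left (subset_insert _ _))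
      fun f hf => hb f (mem_insert_of_mem hf)
    rw [union_insert]
    by_cases he : e ∈ S ∪ T
    · exact ⟨c₁, hc₁, by rwa [insert_eq_of_mem he]⟩
    · have hsub : near G e ∩ (S ∪ T) ⊆ near G e \ W := by
        intro f hf
        rw [mem_inter] at hf
        refine mem_sdiff.2 ⟨hf.1, ?_⟩
        rcases mem_union.1 hf.2 with h' | h'
        · exact Finset.disjoint_left.1 hSW h'
        · exact Finset.disjoint_left.1 hTW (mem_insert_of_mem h')
      obtain ⟨k, hk⟩ := exists_notMem_of_card_le
        ((card_le_card (image_subset_image (f := c₁) hsub)).trans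
          (hb e (mem_insert_self _ _) c₁ hc₁))
      refine ⟨Function.update c₁ e k, fun f hf => ?_, hp.update he hk⟩
      rw [Function.update_of_ne, hc₁ f hf]
      rintro rfl
      exact he (mem_union_left _ hf)

lemma near_subset {x y : V} :
    near G s(x, y) ⊆ ((nbrs G x).erase y ∪ (nbrs G y).erase x).biUnion (inc G) := by
  intro f hf
  obtain ⟨hf, hne, hn⟩ := mem_near.1 hf
  induction f with | _ a b
  rw [edgesNear_mk] at hn
  rw [SimpleGraph.mem_edgeSet] at hf
  have hf' := hf.symm
  simp only [mem_biUnion, mem_union, mem_erase, mem_nbrs, mem_inc, SimpleGraph.mem_edgeSet,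
    Sym2.mem_iff]
  rw [Ne, Sym2.eq_iff] at hne
  by_cases h1 : ((a ≠ y ∧ G.Adj x a) ∨ (a ≠ x ∧ G.Adj y a))
  · exact ⟨a, h1, hf, Or.inl rfl⟩
  · refine ⟨b, ?_, hf, Or.inr rfl⟩
    grind

/-- Each path `w x u` lying on further four-cycles lowers the number of edges near `wx`. -/
lemma card_near_add_sum_le (hd : ∀ v, (nbrs G v).card = 5) {w x : V} (hwx : G.Adj w x) :
    (near G s(w, x)).card + ∑ u ∈ (nbrs G x).erase w, (nbrs G w ∩ nbrs G u).card ≤ 44 := by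
  set D : V → Finset (Sym2 V) := fun u =>
    inc G u \ ((nbrs G w ∩ nbrs G u).erase x).image (fun d => s(u, d)) with hD
  have hsub : near G s(w, x) ⊆
      ((nbrs G w).erase x).biUnion (inc G) ∪ ((nbrs G x).erase w).biUnion D := by
    intro f hf
    obtain ⟨u, hu, hfu⟩ := mem_biUnion.1 (near_subset hf)
    rcases mem_union.1 hu with hu | hu
    · exact mem_union_left _ (mem_biUnion.2 ⟨u, hu, hfu⟩)
    · by_cases hfD : f ∈ D u
      · exact mem_union_right _ (mem_biUnion.2 ⟨u, hu, hfD⟩)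
      · have hfi : f ∈ ((nbrs G w ∩ nbrs G u).erase x).image (fun d => s(u, d)) := by
          by_contra hcon
          exact hfD (mem_sdiff.2 ⟨hfu, hcon⟩)
        obtain ⟨d, hd', rfl⟩ := mem_image.1 hfi
        simp only [mem_erase, mem_inter, mem_nbrs] at hd'
        refine mem_union_left _ (mem_biUnion.2 ⟨d, by simp [hd'.1, hd'.2.1], ?_⟩)
        rw [mem_inc]
        exact ⟨hd'.2.2, by simp⟩
  have h1 : (((nbrs G w).erase x).biUnion (inc G)).card ≤ 20 := by
    refine (card_biUnion_le_card_mul _ _ 5 fun v _ => ?_).trans ?_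
    · rw [card_inc, hd]
    · rw [card_erase_of_mem (by simpa), hd]
  have h2 : ∀ u ∈ (nbrs G x).erase w, (D u).card + (nbrs G w ∩ nbrs G u).card = 6 := by
    intro u hu
    simp only [mem_erase, mem_nbrs] at hu
    have hx : x ∈ nbrs G w ∩ nbrs G u := by simp [hwx, hu.2.symm]
    have hc : (((nbrs G w ∩ nbrs G u).erase x).image (fun d => s(u, d))).card =
        (nbrs G w ∩ nbrs G u).card - 1 := by
      rw [card_image_of_injective, card_erase_of_mem hx]
      exact fun a b h => Sym2.congr_right.1 h
    have hs : ((nbrs G w ∩ nbrs G u).erase x).image (fun d => s(u, d)) ⊆ inc G u :=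
      image_subset_image ((erase_subset _ _).trans inter_subset_right)
    have hle := card_le_card hs
    have hpos : 0 < (nbrs G w ∩ nbrs G u).card := card_pos.2 ⟨x, hx⟩
    rw [hD]
    simp only
    rw [card_sdiff_of_subset hs]
    rw [card_inc, hd] at *
    omega
  have h3 := sum_congr rfl h2
  rw [sum_add_distrib, sum_const, card_erase_of_mem (by simpa using hwx.symm), hd] at h3
  have h4 := card_le_card hsub
  have h5 := card_union_le (((nbrs G w).erase x).biUnion (inc G)) (((nbrs G x).erase w).biUnion D)
  have h6 := card_biUnion_le (s := (nbrs G x).erase w) (t := D)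
  simp only [smul_eq_mul] at h3
  omega

lemma one_le_codegree {w x u : V} (hwx : G.Adj w x) (hu : u ∈ (nbrs G x).erase w) :
    1 ≤ (nbrs G w ∩ nbrs G u).card := by
  refine card_pos.2 ⟨x, ?_⟩
  simp only [mem_erase, mem_nbrs] at hu
  simp [hwx, hu.2.symm]

lemma card_near_add_codegree_le (hd : ∀ v, (nbrs G v).card = 5) {w x y : V} (hwx : G.Adj w x)
    (hxy : G.Adj x y) (hwy : w ≠ y) :
    (near G s(w, x)).card + (nbrs G w ∩ nbrs G y).card ≤ 41 := by
  have h := card_near_add_sum_le hd hwx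
  have hy : y ∈ (nbrs G x).erase w := by simp [hwy.symm, hxy]
  have h1 : (((nbrs G x).erase w).erase y).card = 3 := by
    rw [card_erase_of_mem hy, card_erase_of_mem (by simpa using hwx.symm), hd]
  have h2 := card_nsmul_le_sum (((nbrs G x).erase w).erase y)
    (fun u => (nbrs G w ∩ nbrs G u).card) 1
    fun u hu => one_le_codegree hwx (mem_of_mem_erase hu)
  rw [← add_sum_erase _ _ hy] at h
  simp only [h1, smul_eq_mul] at h2
  omega

lemma card_near_add_codegree_add_codegree_le (hd : ∀ v, (nbrs G v).card = 5) {w x y q : V}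
    (hwx : G.Adj w x) (hxy : G.Adj x y) (hwy : w ≠ y) (hxq : G.Adj x q) (hwq : w ≠ q)
    (hyq : y ≠ q) :
    (near G s(w, x)).card + (nbrs G w ∩ nbrs G y).card + (nbrs G w ∩ nbrs G q).card ≤ 42 := by
  have h := card_near_add_sum_le hd hwx
  have hy : y ∈ (nbrs G x).erase w := by simp [hwy.symm, hxy]
  have hq : q ∈ ((nbrs G x).erase w).erase y := by simp [hwq.symm, hxq, hyq.symm]
  have h1 : ((((nbrs G x).erase w).erase y).erase q).card = 2 := by
    rw [card_erase_of_mem hq, card_erase_of_mem hy, card_erase_of_mem (by simpa using hwx.symm),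
      hd]
  have h2 := card_nsmul_le_sum ((((nbrs G x).erase w).erase y).erase q)
    (fun u => (nbrs G w ∩ nbrs G u).card) 1
    fun u hu => one_le_codegree hwx (mem_of_mem_erase (mem_of_mem_erase hu))
  rw [← add_sum_erase _ _ hy, ← add_sum_erase _ _ hq] at h
  simp only [h1, smul_eq_mul] at h2
  omega

lemma card_near_le (hd : ∀ v, (nbrs G v).card = 5) {e : Sym2 V} (he : e ∈ G.edgeSet) :
    (near G e).card ≤ 40 := by
  induction e with | _ w x
  rw [SimpleGraph.mem_edgeSet] at he
  have h := card_near_add_sum_le hd he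
  have h2 := card_nsmul_le_sum ((nbrs G x).erase w)
    (fun u => (nbrs G w ∩ nbrs G u).card) 1 fun u hu => one_le_codegree he hu
  rw [card_erase_of_mem (by simpa using he.symm), hd, smul_eq_mul] at h2
  omega

/-- Color every edge avoiding `B`, starting from a precolored matching `M`. -/
lemma exists_outer (hconn : G.Connected) (hd : ∀ v, (nbrs G v).card = 5)
    {M : Finset (Sym2 V)} {c₀ : Sym2 V → Fin 37} (hM : ProperOn G c₀ M)
    (hM1 : ∀ e ∈ M, ∀ f ∈ M, ∀ b, b ∈ e → b ∈ f → e = f) (B : Finset V) (hB : B.Nonempty) :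
    ∃ c : Sym2 V → Fin 37, (∀ e ∈ M, c e = c₀ e) ∧
      ProperOn G c (M ∪ univ.filter (fun e => ∀ b ∈ B, b ∉ e)) := by
  induction hn : Bᶜ.card using Nat.strong_induction_on generalizing B with
  | _ n ih =>
  by_cases hBu : B = univ
  · refine ⟨c₀, fun _ _ => rfl, hM.mono fun e he _ => ?_⟩
    rcases mem_union.1 he with he | he
    · exact he
    · induction e with | _ a b
      simp [hBu] at he
      exact absurd rfl (he a).1
  · obtain ⟨v, hv⟩ := hB
    obtain ⟨t, ht⟩ : ∃ t, t ∉ B := by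
      by_contra! h
      exact hBu (eq_univ_iff_forall.2 h)
    obtain ⟨p⟩ := hconn.preconnected v t
    obtain ⟨d, -, hb, hu⟩ := p.exists_boundary_dart (B : Set V) (by simpa) (by simpa)
    have hbu := d.adj
    generalize d.fst = b at *
    generalize d.snd = u at *
    simp only [mem_coe] at hb hu
    obtain ⟨c, hc, hp⟩ := ih (insert u B)ᶜ.card (by
      rw [← hn]
      apply card_lt_card
      rw [compl_insert]
      exact erase_ssubset (by simpa)) (insert u B) ⟨u, mem_insert_self _ _⟩ rfl
    set T : Finset (Sym2 V) :=
      univ.filter (fun e => e ∈ G.edgeSet ∧ u ∈ e ∧ (∀ b ∈ B, b ∉ e) ∧ e ∉ M) with hT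
    obtain ⟨c', hc', hp'⟩ := hp.greedy (W := inc G b \ M) T (by
        rw [Finset.disjoint_left]
        intro e he heW
        rw [mem_sdiff, mem_inc] at heW
        rcases mem_union.1 he with he | he
        · exact heW.2 he
        · exact (mem_filter.1 he).2 b (mem_insert_of_mem hb) heW.1.2)
      (by
        rw [Finset.disjoint_left]
        intro e he heW
        rw [mem_sdiff, mem_inc] at heW
        exact (mem_filter.1 he).2.2.2.1 b hb heW.1.2)
      (by
        intro e he c' _
        obtain ⟨heE, hue, heB, -⟩ := (mem_filter.1 he).2
        refine card_image_le.trans (card_sdiff_le_of_subset (m := 4) ?_ (card_near_le hd heE) ?_)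
        · intro f hf
          rw [mem_sdiff, mem_inc] at hf
          refine mem_near.2 ⟨hf.1.1, ?_, Or.inr ⟨u, b, hue, hf.1.2, hbu.symm⟩⟩
          rintro rfl
          exact heB b hb hf.1.2
        · have h1 : (inc G b ∩ M).card ≤ 1 := by
            rw [card_le_one]
            intro e he f hf
            rw [mem_inter, mem_inc] at he hf
            exact hM1 e he.2 f hf.2 b he.1.2 hf.1.2
          have h2 := card_sdiff_add_card_inter (inc G b) M
          rw [card_inc, hd] at h2
          omega)
    refine ⟨c', fun e he => by rw [hc' e (mem_union_left _ he), hc e he], hp'.mono ?_⟩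
    intro e he heE
    by_cases heM : e ∈ M
    · exact mem_union_left _ (mem_union_left _ heM)
    have he' : ∀ b ∈ B, b ∉ e := by simpa [heM] using he
    by_cases hue : u ∈ e
    · exact mem_union_right _ (mem_filter.2 ⟨mem_univ _, heE, hue, he', heM⟩)
    · refine mem_union_left _ (mem_union_right _ (mem_filter.2 ⟨mem_univ _, ?_⟩))
      intro b hb
      rcases mem_insert.1 hb with rfl | hb
      · exact hue
      · exact he' b hb

/-- The set `R` of precolored edges near `e` is redundant for the palette seen by `e`. -/
lemma card_image_near_add_card_le {c c' : Sym2 V → Fin 37} {S R W : Finset (Sym2 V)}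
    {e : Sym2 V} (hSW : Disjoint S W) (hRS : R ⊆ S) (hRn : R ⊆ near G e)
    (hR : ∀ r ∈ R, ∃ s ∈ S, s ∉ R ∧ c s = c r ∧ s ∈ near G e)
    (hc' : ∀ f ∈ S, c' f = c f) :
    ((near G e \ W).image c').card + R.card ≤ (near G e \ W).card := by
  have hS : ∀ s ∈ S, s ∉ W := fun s hs => Finset.disjoint_left.1 hSW hs
  refine card_image_add_card_le (fun r hr => mem_sdiff.2 ⟨hRn hr, hS r (hRS hr)⟩) fun r hr => ?_
  obtain ⟨s, hs, hsR, hcs, hsn⟩ := hR r hr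
  exact ⟨s, mem_sdiff.2 ⟨hsn, hS s hs⟩, hsR, by rw [hc' s hs, hc' r (hRS hr), hcs]⟩

/-- Complete a partial coloring: first the edges outside `F`, then `F`, and `f₀` last. -/
lemma ProperOn.finish {c : Sym2 V → Fin 37} {S F R : Finset (Sym2 V)} {f₀ : Sym2 V}
    (hp : ProperOn G c S) (hf₀ : f₀ ∈ F) (hSF : Disjoint S F)
    (hspoke : ∀ e ∈ G.edgeSet, e ∉ S → e ∉ F →
      F ⊆ near G e ∧ (near G e).card ≤ 36 + F.card)
    (hFF : ∀ f ∈ F, f ≠ f₀ → f₀ ∈ near G f) (hRS : R ⊆ S) (hRn : ∀ f ∈ F, R ⊆ near G f)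
    (hR : ∀ r ∈ R, ∃ s ∈ S, s ∉ R ∧ c s = c r ∧ ∀ f ∈ F, s ∈ near G f)
    (hcard : ∀ f ∈ F, (near G f).card ≤ 37 + R.card)
    (hlast : ∀ c' : Sym2 V → Fin 37, (∀ f ∈ S, c' f = c f) →
      ((near G f₀).image c').card ≤ 36) :
    ∃ c' : Sym2 V → Fin 37, ProperOn G c' univ := by
  obtain ⟨c₁, hc₁, hp₁⟩ := hp.greedy (W := F)
    (univ.filter fun e => e ∈ G.edgeSet ∧ e ∉ S ∧ e ∉ F) hSF
    (by
      rw [Finset.disjoint_left]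
      intro e he
      exact (mem_filter.1 he).2.2.2)
    (by
      intro e he c' _
      obtain ⟨heE, heS, heF⟩ := (mem_filter.1 he).2
      obtain ⟨h1, h2⟩ := hspoke e heE heS heF
      exact card_image_le.trans (card_sdiff_le_of_subset h1 h2 le_rfl))
  have hf₀S : f₀ ∉ S := fun h => Finset.disjoint_left.1 hSF h hf₀
  obtain ⟨c₂, hc₂, hp₂⟩ := hp₁.greedy (W := {f₀}) (F.erase f₀) (by simp [hf₀S, hf₀]) (by simp)
    (by
      intro f hf c' hc'
      rw [mem_erase] at hf
      have h1 := card_image_near_add_card_le (e := f) (W := {f₀}) (c := c) (c' := c')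
        (by simpa using hf₀S) hRS (hRn f hf.2)
        (fun r hr => by
          obtain ⟨s, hs, hsR, hcs, hsn⟩ := hR r hr
          exact ⟨s, hs, hsR, hcs, hsn f hf.2⟩)
        (fun g hg => by rw [hc' g (mem_union_left _ hg), hc₁ g hg])
      have h2 := card_sdiff_le_of_subset (N := near G f) (W := {f₀}) (m := 1)
        (n := 36 + R.card) (by simpa using hFF f hf.2 hf.1)
        (by have := hcard f hf.2; omega) (by simp)
      omega)
  obtain ⟨c₃, -, hp₃⟩ := hp₂.greedy (W := ∅) {f₀} (by simp) (by simp)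
    (by
      intro f hf c' hc'
      rw [mem_singleton] at hf
      subst hf
      rw [sdiff_empty]
      refine hlast c' fun g hg => ?_
      rw [hc' g (mem_union_left _ (mem_union_left _ hg)), hc₂ g (mem_union_left _ hg), hc₁ g hg])
  refine ⟨c₃, hp₃.mono fun e _ he => ?_⟩
  simp only [mem_union, mem_filter, mem_univ, true_and, mem_erase, mem_singleton]
  tauto

lemma ProperOn.finish_of_card_le {c : Sym2 V → Fin 37} {S F R : Finset (Sym2 V)}
    (hp : ProperOn G c S) (hF : F.Nonempty) (hSF : Disjoint S F)
    (hspoke : ∀ e ∈ G.edgeSet, e ∉ S → e ∉ F →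
      F ⊆ near G e ∧ (near G e).card ≤ 36 + F.card)
    (hFF : ∀ f ∈ F, ∀ g ∈ F, f ≠ g → g ∈ near G f) (hRS : R ⊆ S)
    (hRn : ∀ f ∈ F, R ⊆ near G f)
    (hR : ∀ r ∈ R, ∃ s ∈ S, s ∉ R ∧ c s = c r ∧ ∀ f ∈ F, s ∈ near G f)
    (hcard : ∀ f ∈ F, (near G f).card ≤ 36 + R.card) :
    ∃ c' : Sym2 V → Fin 37, ProperOn G c' univ := by
  obtain ⟨f₀, hf₀⟩ := hF
  refine hp.finish hf₀ hSF hspoke (fun f hf => hFF f hf f₀ hf₀) hRS hRn hR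
    (fun f hf => (hcard f hf).trans (by omega)) fun c' hc' => ?_
  have h1 := card_image_near_add_card_le (e := f₀) (W := ∅) (c := c) (c' := c')
    (by simp) hRS (hRn f₀ hf₀)
    (fun r hr => by
      obtain ⟨s, hs, hsR, hcs, hsn⟩ := hR r hr
      exact ⟨s, hs, hsR, hcs, hsn f₀ hf₀⟩) hc'
  rw [sdiff_empty] at h1
  have := hcard f₀ hf₀
  omega

lemma card_near_le_of_triangle (hd : ∀ v, (nbrs G v).card = 5) {x y z : V} (hxy : G.Adj x y)
    (hyz : G.Adj y z) (hxz : G.Adj x z) : (near G s(x, y)).card ≤ 35 := by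
  have h1 : ((nbrs G x).erase y ∪ (nbrs G y).erase x).card ≤ 7 := by
    have h2 := card_union_add_card_inter ((nbrs G x).erase y) ((nbrs G y).erase x)
    rw [card_erase_of_mem (by simpa), card_erase_of_mem (by simpa using hxy.symm), hd, hd] at h2
    have h3 : 0 < ((nbrs G x).erase y ∩ (nbrs G y).erase x).card :=
      card_pos.2 ⟨z, by simp [hxz, hyz, hxz.ne']⟩
    omega
  have h4 := card_biUnion_le_card_mul ((nbrs G x).erase y ∪ (nbrs G y).erase x) (inc G) 5
    fun v _ => by rw [card_inc, hd]
  have h5 := card_le_card (near_subset (G := G) (x := x) (y := y))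
  omega

lemma card_near_le_of_triangle_at (hd : ∀ v, (nbrs G v).card = 5) {x y z a : V}
    (hxy : G.Adj x y) (hyz : G.Adj y z) (hxz : G.Adj x z) (hxa : G.Adj x a) (hya : y ≠ a)
    (hza : z ≠ a) : (near G s(x, a)).card ≤ 39 := by
  set P := (nbrs G x).erase a ∪ (nbrs G a).erase x with hP
  have hzP : z ∈ P := by simp [hP, hza, hxz]
  have hsub : near G s(x, a) ⊆ (P.erase z).biUnion (inc G) ∪ (inc G z).erase s(y, z) := by
    intro f hf
    obtain ⟨u, hu, hfu⟩ := mem_biUnion.1 (near_subset hf)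
    by_cases hfy : f = s(y, z)
    · refine mem_union_left _ (mem_biUnion.2 ⟨y, ?_, ?_⟩)
      · simp [hP, hya, hxy, hyz.ne]
      · rw [hfy, mem_inc]
        exact ⟨hyz, by simp⟩
    · by_cases huz : u = z
      · subst huz
        exact mem_union_right _ (mem_erase.2 ⟨hfy, hfu⟩)
      · exact mem_union_left _ (mem_biUnion.2 ⟨u, mem_erase.2 ⟨huz, hu⟩, hfu⟩)
  have h1 : P.card ≤ 8 := by
    refine (card_union_le _ _).trans ?_
    rw [card_erase_of_mem (by simpa), card_erase_of_mem (by simpa using hxa.symm), hd, hd]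
  have h2 := card_erase_of_mem hzP
  have h3 := card_biUnion_le_card_mul (P.erase z) (inc G) 5 fun v _ => by rw [card_inc, hd]
  have h4 : ((inc G z).erase s(y, z)).card = 4 := by
    rw [card_erase_of_mem (by rw [mem_inc]; exact ⟨hyz, by simp⟩), card_inc, hd]
  have h5 := (card_le_card hsub).trans (card_union_le _ _)
  omega

lemma exists_coloring_of_triangle (hconn : G.Connected) (hd : ∀ v, (nbrs G v).card = 5)
    {x y z : V} (hxy : G.Adj x y) (hyz : G.Adj y z) (hxz : G.Adj x z) :
    ∃ c : Sym2 V → Fin 37, ProperOn G c univ := by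
  obtain ⟨c, -, hp⟩ := exists_outer hconn hd (M := ∅) (c₀ := fun _ => 0)
    (by simp [ProperOn]) (by simp) {x, y, z} ⟨x, by simp⟩
  rw [empty_union] at hp
  have hne1 := hxy.ne
  have hne2 := hyz.ne
  have hne3 := hxz.ne
  have hyx := hxy.symm
  have hzy := hyz.symm
  have hzx := hxz.symm
  have hF : ({s(x, y), s(y, z), s(x, z)} : Finset (Sym2 V)).card = 3 := by
    rw [card_eq_three]
    exact ⟨_, _, _, by grind [Sym2.eq_iff], by grind [Sym2.eq_iff], by grind [Sym2.eq_iff], rfl⟩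
  refine hp.finish_of_card_le (F := {s(x, y), s(y, z), s(x, z)}) (R := ∅) ⟨s(x, y), by simp⟩
    ?_ ?_ ?_ (by simp) (by simp) (by simp) ?_
  · rw [Finset.disjoint_left]
    intro e he
    simp only [mem_filter, mem_univ, true_and, mem_insert, mem_singleton] at he ⊢
    rintro (rfl | rfl | rfl) <;> simp at he
  · intro e heE heS heF
    rw [hF]
    have key : ∀ v a, (v = x ∨ v = y ∨ v = z) → G.Adj v a → s(v, a) ∉
        ({s(x, y), s(y, z), s(x, z)} : Finset (Sym2 V)) →
        ({s(x, y), s(y, z), s(x, z)} : Finset (Sym2 V)) ⊆ near G s(v, a) ∧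
        (near G s(v, a)).card ≤ 36 + 3 := by
      intro v a hv hva hF'
      refine ⟨?_, ?_⟩
      · intro f hf
        simp only [mem_insert, mem_singleton] at hf
        refine mem_near.2 ⟨?_, ?_, ?_⟩
        · rcases hf with rfl | rfl | rfl <;> assumption
        · rintro rfl
          exact hF' (by simpa using hf)
        · rcases hv with rfl | rfl | rfl <;> rcases hf with rfl | rfl | rfl <;>
            simp [edgesNear_mk, *]
      · rcases hv with rfl | rfl | rfl
        · exact card_near_le_of_triangle_at hd hxy hyz hxz hva (by rintro rfl; simp at hF')
            (by rintro rfl; simp at hF')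
        · exact card_near_le_of_triangle_at hd hyx hxz hyz hva (by rintro rfl; simp at hF')
            (by rintro rfl; simp at hF')
        · exact card_near_le_of_triangle_at hd hzx hxy hzy hva (by rintro rfl; simp at hF')
            (by rintro rfl; simp at hF')
    simp only [mem_filter, mem_univ, true_and, not_forall, not_not] at heS
    obtain ⟨v, hv, hve⟩ := heS
    obtain ⟨a, rfl⟩ := Sym2.mem_iff_exists.1 hve
    exact key v a (by simpa using hv) heE heF
  · intro f hf g hg hfg
    simp only [mem_insert, mem_singleton] at hf hg
    refine mem_near.2 ⟨?_, hfg.symm, ?_⟩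
    · rcases hg with rfl | rfl | rfl <;> assumption
    · rcases hf with rfl | rfl | rfl <;> rcases hg with rfl | rfl | rfl <;>
        simp [edgesNear_mk]
  · intro f hf
    simp only [mem_insert, mem_singleton] at hf
    refine le_trans ?_ (show 35 ≤ _ by omega)
    rcases hf with rfl | rfl | rfl
    · exact card_near_le_of_triangle hd hxy hyz hxz
    · exact card_near_le_of_triangle hd hyz hzx hyx
    · exact card_near_le_of_triangle hd hxz hzy hxy

lemma eq_of_codegree_le_one (hcod : ∀ u w, u ≠ w → (nbrs G u ∩ nbrs G w).card ≤ 1)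
    {u w a b : V} (huw : u ≠ w) (hua : G.Adj u a) (hwa : G.Adj w a) (hub : G.Adj u b)
    (hwb : G.Adj w b) : a = b :=
  card_le_one.1 (hcod u w huw) a (by simp [hua, hwa]) b (by simp [hub, hwb])

lemma exists_adj_notMem (hd : ∀ v, (nbrs G v).card = 5) (p v : V) {U : Finset V}
    (hU : U.card ≤ 3) : ∃ b, G.Adj p b ∧ b ≠ v ∧ b ∉ U := by
  by_contra! h
  have hsub : nbrs G p ⊆ insert v U := by
    intro b hb
    rw [mem_insert]
    by_cases hbv : b = v
    · exact Or.inl hbv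
    · exact Or.inr (h b (by simpa using hb) hbv)
  have h1 := (card_le_card hsub).trans (card_insert_le _ _)
  rw [hd] at h1
  omega

/-- Completing two independent vertices to an independent transversal of the second
neighbourhood. -/
lemma exists_transversal_of_pair (hd : ∀ v, (nbrs G v).card = 5)
    (htf : ∀ a b c, G.Adj a b → G.Adj b c → G.Adj a c → False)
    (hcod : ∀ u w, u ≠ w → (nbrs G u ∩ nbrs G w).card ≤ 1) {v p₁ p₂ p₃ p₄ p₅ u₁ u₂ : V}
    (hp₁ : G.Adj v p₁) (hp₂ : G.Adj v p₂) (hp₃ : G.Adj v p₃) (hp₄ : G.Adj v p₄)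
    (hp₅ : G.Adj v p₅) (hu₁ : G.Adj p₁ u₁) (hu₂ : G.Adj p₂ u₂)
    (hu₁₂ : ¬ G.Adj u₁ u₂)
    (h₅ : ((nbrs G p₅ ∩ nbrs G u₁) ∪ (nbrs G p₅ ∩ nbrs G u₂)).card ≤ 1) :
    ∃ u₃ u₄ u₅, (G.Adj p₃ u₃ ∧ u₃ ≠ v) ∧ (G.Adj p₄ u₄ ∧ u₄ ≠ v) ∧ (G.Adj p₅ u₅ ∧ u₅ ≠ v) ∧
      (¬ G.Adj u₁ u₂ ∧ ¬ G.Adj u₁ u₃ ∧ ¬ G.Adj u₁ u₄ ∧ ¬ G.Adj u₁ u₅) ∧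
      (¬ G.Adj u₂ u₃ ∧ ¬ G.Adj u₂ u₄ ∧ ¬ G.Adj u₂ u₅) ∧ (¬ G.Adj u₃ u₄ ∧ ¬ G.Adj u₃ u₅) ∧
      ¬ G.Adj u₄ u₅ := by
  have hne : ∀ {p q u}, G.Adj v p → G.Adj v q → G.Adj p u → q ≠ u := by
    rintro p q u hp hq hu rfl
    exact htf v p q hp hu hq
  obtain ⟨u₃, hu₃, hv₃, hn₃⟩ := exists_adj_notMem hd p₃ v
    (U := (nbrs G p₃ ∩ nbrs G u₁) ∪ (nbrs G p₃ ∩ nbrs G u₂)) (by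
      have h1 := card_union_le (nbrs G p₃ ∩ nbrs G u₁) (nbrs G p₃ ∩ nbrs G u₂)
      have h2 := hcod p₃ u₁ (hne hp₁ hp₃ hu₁)
      have h3 := hcod p₃ u₂ (hne hp₂ hp₃ hu₂)
      omega)
  obtain ⟨u₄, hu₄, hv₄, hn₄⟩ := exists_adj_notMem hd p₄ v
    (U := ((nbrs G p₄ ∩ nbrs G u₁) ∪ (nbrs G p₄ ∩ nbrs G u₂)) ∪ (nbrs G p₄ ∩ nbrs G u₃)) (by
      have h1 := card_union_le (nbrs G p₄ ∩ nbrs G u₁) (nbrs G p₄ ∩ nbrs G u₂)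
      have h1' := card_union_le ((nbrs G p₄ ∩ nbrs G u₁) ∪ (nbrs G p₄ ∩ nbrs G u₂))
        (nbrs G p₄ ∩ nbrs G u₃)
      have h2 := hcod p₄ u₁ (hne hp₁ hp₄ hu₁)
      have h3 := hcod p₄ u₂ (hne hp₂ hp₄ hu₂)
      have h4 := hcod p₄ u₃ (hne hp₃ hp₄ hu₃)
      omega)
  obtain ⟨u₅, hu₅, hv₅, hn₅⟩ := exists_adj_notMem hd p₅ v
    (U := (((nbrs G p₅ ∩ nbrs G u₁) ∪ (nbrs G p₅ ∩ nbrs G u₂)) ∪ (nbrs G p₅ ∩ nbrs G u₃)) ∪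
      (nbrs G p₅ ∩ nbrs G u₄)) (by
      have h1 := card_union_le ((nbrs G p₅ ∩ nbrs G u₁) ∪ (nbrs G p₅ ∩ nbrs G u₂))
        (nbrs G p₅ ∩ nbrs G u₃)
      have h1' := card_union_le (((nbrs G p₅ ∩ nbrs G u₁) ∪ (nbrs G p₅ ∩ nbrs G u₂)) ∪
        (nbrs G p₅ ∩ nbrs G u₃)) (nbrs G p₅ ∩ nbrs G u₄)
      have h3 := hcod p₅ u₃ (hne hp₃ hp₅ hu₃)
      have h4 := hcod p₅ u₄ (hne hp₄ hp₅ hu₄)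
      omega)
  simp only [mem_union, mem_inter, mem_nbrs] at hn₃ hn₄ hn₅
  exact ⟨u₃, u₄, u₅, ⟨hu₃, hv₃⟩, ⟨hu₄, hv₄⟩, ⟨hu₅, hv₅⟩, by tauto, by tauto, by tauto, by tauto⟩

lemma exists_transversal_of_isolated (hd : ∀ v, (nbrs G v).card = 5)
    (htf : ∀ a b c, G.Adj a b → G.Adj b c → G.Adj a c → False)
    (hcod : ∀ u w, u ≠ w → (nbrs G u ∩ nbrs G w).card ≤ 1) {v p₁ p₂ p₃ p₄ p₅ u₁ : V}
    (hp₁ : G.Adj v p₁) (hp₂ : G.Adj v p₂) (hp₃ : G.Adj v p₃) (hp₄ : G.Adj v p₄)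
    (hp₅ : G.Adj v p₅) (hu₁ : G.Adj p₁ u₁)
    (h₅ : nbrs G p₅ ∩ nbrs G u₁ = ∅) :
    ∃ u₂ u₃ u₄ u₅, (G.Adj p₂ u₂ ∧ u₂ ≠ v) ∧ (G.Adj p₃ u₃ ∧ u₃ ≠ v) ∧
      (G.Adj p₄ u₄ ∧ u₄ ≠ v) ∧ (G.Adj p₅ u₅ ∧ u₅ ≠ v) ∧
      (¬ G.Adj u₁ u₂ ∧ ¬ G.Adj u₁ u₃ ∧ ¬ G.Adj u₁ u₄ ∧ ¬ G.Adj u₁ u₅) ∧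
      (¬ G.Adj u₂ u₃ ∧ ¬ G.Adj u₂ u₄ ∧ ¬ G.Adj u₂ u₅) ∧ (¬ G.Adj u₃ u₄ ∧ ¬ G.Adj u₃ u₅) ∧
      ¬ G.Adj u₄ u₅ := by
  have hne : ∀ {p q u}, G.Adj v p → G.Adj v q → G.Adj p u → q ≠ u := by
    rintro p q u hp hq hu rfl
    exact htf v p q hp hu hq
  obtain ⟨u₂, hu₂, hv₂, hn₂⟩ := exists_adj_notMem hd p₂ v (U := nbrs G p₂ ∩ nbrs G u₁)
    ((hcod p₂ u₁ (hne hp₁ hp₂ hu₁)).trans (by omega))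
  have hu₁₂ : ¬ G.Adj u₁ u₂ := fun h => hn₂ (by simp [hu₂, h])
  obtain ⟨u₃, u₄, u₅, h3, h4, h5, h⟩ := exists_transversal_of_pair hd htf hcod hp₁ hp₂ hp₃ hp₄
    hp₅ hu₁ hu₂ hu₁₂ (by
      rw [h₅, empty_union]
      exact hcod p₅ u₂ (hne hp₂ hp₅ hu₂))
  exact ⟨u₂, u₃, u₄, u₅, ⟨hu₂, hv₂⟩, h3, h4, h5, h⟩

lemma exists_transversal (hd : ∀ v, (nbrs G v).card = 5)
    (htf : ∀ a b c, G.Adj a b → G.Adj b c → G.Adj a c → False)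
    (hcod : ∀ u w, u ≠ w → (nbrs G u ∩ nbrs G w).card ≤ 1) {v : V} {p : Fin 5 → V}
    (hp : ∀ i, G.Adj v (p i)) :
    ∃ u : Fin 5 → V, (∀ i, G.Adj (p i) (u i) ∧ u i ≠ v) ∧ ∀ i j, i < j → ¬ G.Adj (u i) (u j) := by
  suffices h : ∃ u₁ u₂ u₃ u₄ u₅, (G.Adj (p 0) u₁ ∧ u₁ ≠ v) ∧ (G.Adj (p 1) u₂ ∧ u₂ ≠ v) ∧
      (G.Adj (p 2) u₃ ∧ u₃ ≠ v) ∧ (G.Adj (p 3) u₄ ∧ u₄ ≠ v) ∧ (G.Adj (p 4) u₅ ∧ u₅ ≠ v) ∧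
      (¬ G.Adj u₁ u₂ ∧ ¬ G.Adj u₁ u₃ ∧ ¬ G.Adj u₁ u₄ ∧ ¬ G.Adj u₁ u₅) ∧
      (¬ G.Adj u₂ u₃ ∧ ¬ G.Adj u₂ u₄ ∧ ¬ G.Adj u₂ u₅) ∧ (¬ G.Adj u₃ u₄ ∧ ¬ G.Adj u₃ u₅) ∧
      ¬ G.Adj u₄ u₅ by
    obtain ⟨u₁, u₂, u₃, u₄, u₅, h⟩ := h
    refine ⟨![u₁, u₂, u₃, u₄, u₅], ?_, ?_⟩
    · intro i
      fin_cases i <;> simp <;> tauto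
    · intro i j hij
      fin_cases i <;> fin_cases j <;> simp at hij <;> simp <;> tauto
  have hne : ∀ {p q u}, G.Adj v p → G.Adj v q → G.Adj p u → q ≠ u := by
    rintro p q u hp hq hu rfl
    exact htf v p q hp hu hq
  obtain ⟨u₁, hu₁, hv₁, -⟩ := exists_adj_notMem hd (p 0) v (U := ∅) (by simp)
  rcases (nbrs G (p 4) ∩ nbrs G u₁).eq_empty_or_nonempty with h₅ | ⟨x, hx⟩
  · obtain ⟨u₂, u₃, u₄, u₅, h⟩ := exists_transversal_of_isolated hd htf hcod (hp 0) (hp 1) (hp 2)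
      (hp 3) (hp 4) hu₁ h₅
    exact ⟨u₁, u₂, u₃, u₄, u₅, ⟨hu₁, hv₁⟩, h⟩
  simp only [mem_inter, mem_nbrs] at hx
  have hxv : x ≠ v := by
    rintro rfl
    exact htf _ _ _ (hp 0) hu₁ hx.2.symm
  rcases (nbrs G (p 1) ∩ nbrs G x).eq_empty_or_nonempty with h₅ | ⟨u₂, hu₂⟩
  · obtain ⟨u₁, u₃, u₄, u₂, h⟩ := exists_transversal_of_isolated hd htf hcod (hp 4) (hp 0) (hp 2)
      (hp 3) (hp 1) hx.1 h₅
    refine ⟨u₁, u₂, u₃, u₄, x, ?_⟩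
    simp only [G.adj_comm x, G.adj_comm u₃ u₂, G.adj_comm u₄ u₂] at h
    have := hx.1
    tauto
  · simp only [mem_inter, mem_nbrs] at hu₂
    have hu₁₂ : ¬ G.Adj u₁ u₂ := fun h => htf _ _ _ hx.2 hu₂.2 h
    have hv₂ : u₂ ≠ v := by
      rintro rfl
      exact htf _ _ _ (hp 4) hx.1 hu₂.2.symm
    obtain ⟨u₃, u₄, u₅, h3, h4, h5, h⟩ := exists_transversal_of_pair hd htf hcod (hp 0) (hp 1)
      (hp 2) (hp 3) (hp 4) hu₁ hu₂.1 hu₁₂ (by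
        rw [card_le_one]
        have key : ∀ a ∈ (nbrs G (p 4) ∩ nbrs G u₁) ∪ (nbrs G (p 4) ∩ nbrs G u₂), a = x := by
          intro a ha
          simp only [mem_union, mem_inter, mem_nbrs] at ha
          rcases ha with ha | ha
          · exact eq_of_codegree_le_one hcod (hne (hp 0) (hp 4) hu₁) ha.1 ha.2 hx.1 hx.2
          · exact eq_of_codegree_le_one hcod (hne (hp 1) (hp 4) hu₂.1) ha.1 ha.2 hx.1 hu₂.2.symm
        intro a ha b hb
        rw [key a ha, key b hb])
    exact ⟨u₁, u₂, u₃, u₄, u₅, ⟨hu₁, hv₁⟩, ⟨hu₂.1, hv₂⟩, h3, h4, h5, h⟩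

lemma exists_coloring_of_codegree_le_one (hconn : G.Connected)
    (hd : ∀ v, (nbrs G v).card = 5)
    (htf : ∀ a b c, G.Adj a b → G.Adj b c → G.Adj a c → False)
    (hcod : ∀ u w, u ≠ w → (nbrs G u ∩ nbrs G w).card ≤ 1) :
    ∃ c : Sym2 V → Fin 37, ProperOn G c univ := by
  obtain ⟨v⟩ := hconn.nonempty
  set ε := (equivFinOfCardEq (hd v)).symm with hε
  set p : Fin 5 → V := fun i => ε i with hpdef
  have hp : ∀ i, G.Adj v (p i) := fun i => mem_nbrs.1 (ε i).2
  have hinj : ∀ i j, p i = p j → i = j := fun i j h => ε.injective (Subtype.ext h)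
  have hsurj : ∀ a, G.Adj v a → ∃ i, p i = a := fun a ha => by
    obtain ⟨i, hi⟩ := ε.surjective ⟨a, by simpa using ha⟩
    exact ⟨i, by simp [hpdef, hi]⟩
  obtain ⟨u, hu, hind⟩ := exists_transversal hd htf hcod hp
  have hind' : ∀ i j, ¬ G.Adj (u i) (u j) := by
    intro i j h
    rcases lt_trichotomy i j with hij | rfl | hij
    · exact hind i j hij h
    · exact G.irrefl h
    · exact hind j i hij h.symm
  have hpu : ∀ i j, p i ≠ u j := fun i j h => htf _ _ _ (hp j) (hu j).1 (h ▸ hp i)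
  have hpadj : ∀ i j, ¬ G.Adj (p i) (p j) := fun i j h => htf _ _ _ (hp i) h (hp j)
  have hcommon : ∀ i j a, i ≠ j → G.Adj (p i) a → G.Adj (p j) a → a = v := fun i j a hij h1 h2 =>
    eq_of_codegree_le_one hcod (fun h => hij (hinj i j h)) h1 h2 (hp i).symm (hp j).symm
  have hfar : ∀ i j, i ≠ j → ¬ EdgesNear G s(p i, u i) s(p j, u j) := by
    intro i j hij hn
    rw [edgesNear_mk] at hn
    rcases hn with ((h | h) | (h | h)) | ((h | h) | (h | h))
    · exact hij (hinj i j h)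
    · exact hpu _ _ h
    · exact hpu _ _ h.symm
    · exact (hu i).2 (hcommon i j _ hij (hu i).1 (h ▸ (hu j).1))
    · exact hpadj _ _ h
    · exact (hu j).2 (hcommon i j _ hij h (hu j).1)
    · exact (hu i).2 (hcommon i j _ hij (hu i).1 h.symm)
    · exact hind' _ _ h
  set m : Fin 5 → Sym2 V := fun i => s(p i, u i) with hm
  have hminj : Function.Injective m := by
    intro i j hij
    by_contra hne
    exact hfar i j hne (Or.inl ⟨p i, by simp, by
      have : p i ∈ m i := by simp [hm]
      rw [hij] at this
      exact this⟩)
  obtain ⟨c, hc, hpr⟩ := exists_outer hconn hd (M := univ.image m) (c₀ := fun _ => 0)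
    (by
      intro e he f hf _ _ hne hn
      simp only [mem_image, mem_univ, true_and] at he hf
      obtain ⟨i, rfl⟩ := he
      obtain ⟨j, rfl⟩ := hf
      exact absurd hn (hfar i j fun h => hne (h ▸ rfl)))
    (by
      intro e he f hf b hbe hbf
      simp only [mem_image, mem_univ, true_and] at he hf
      obtain ⟨i, rfl⟩ := he
      obtain ⟨j, rfl⟩ := hf
      by_contra hne
      exact hfar i j (fun h => hne (h ▸ rfl)) (Or.inl ⟨b, hbe, hbf⟩)) {v} ⟨v, by simp⟩
  have hvm : ∀ i, v ∉ m i := fun i h => by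
    rcases Sym2.mem_iff.1 h with h | h
    · exact (hp i).ne h
    · exact (hu i).2 h.symm
  have hnear : ∀ f ∈ inc G v, ∀ i, m i ∈ near G f := by
    intro f hf i
    rw [mem_inc] at hf
    refine mem_near.2 ⟨(hu i).1, ?_, Or.inr ⟨v, p i, hf.2, by simp [hm], hp i⟩⟩
    rintro rfl
    exact hvm i hf.2
  refine hpr.finish_of_card_le (F := inc G v) (R := (univ.erase (0 : Fin 5)).image m) ?_ ?_ ?_ ?_
    ?_ ?_ ?_ ?_
  · rw [← card_pos, card_inc, hd]
    omega
  · rw [Finset.disjoint_left]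
    intro e he hev
    rw [mem_inc] at hev
    simp only [mem_union, mem_image, mem_univ, true_and, mem_filter, mem_singleton,
      forall_eq] at he
    rcases he with ⟨i, rfl⟩ | he
    · exact hvm i hev.2
    · exact he hev.2
  · intro e heE heS heF
    rw [mem_inc] at heF
    simp only [mem_union, mem_image, mem_univ, true_and, mem_filter, mem_singleton,
      forall_eq] at heS
    tauto
  · intro f hf g hg hfg
    rw [mem_inc] at hf hg
    exact mem_near.2 ⟨hg.1, hfg.symm, Or.inl ⟨v, hf.2, hg.2⟩⟩
  · exact (image_subset_image (subset_univ _)).trans subset_union_left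
  · intro f hf e he
    obtain ⟨i, -, rfl⟩ := mem_image.1 he
    exact hnear f hf i
  · intro r hr
    have h0 : m 0 ∈ univ.image m := mem_image_of_mem _ (mem_univ _)
    refine ⟨m 0, mem_union_left _ h0, ?_, ?_, fun f hf => hnear f hf 0⟩
    · intro h
      obtain ⟨i, hi, hi0⟩ := mem_image.1 h
      exact (mem_erase.1 hi).1 (hminj hi0)
    · rw [hc _ h0, hc _ (image_subset_image (subset_univ _) hr)]
  · intro f hf
    rw [card_image_of_injective _ hminj, card_erase_of_mem (mem_univ _)]
    exact card_near_le hd (mem_inc.1 hf).1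

namespace FourCycle

variable {w x y z : V}

lemma cyc_mem_near (h : FourCycle G w x y z) {v : V} (hv : v ∈ ({w, x, y, z} : Finset V))
    {e f : Sym2 V} (hve : v ∈ e) (hf : f ∈ cyc w x y z) (hfe : f ≠ e) : f ∈ near G e :=
  mem_near.2 ⟨h.cyc_subset_edgeSet hf, hfe, h.edgesNear hv hve hf⟩

lemma mem_near_cyc (h : FourCycle G w x y z) {v : V} (hv : v ∈ ({w, x, y, z} : Finset V))
    {e f : Sym2 V} (he : e ∈ G.edgeSet) (hve : v ∈ e) (hf : f ∈ cyc w x y z) (hfe : f ≠ e) :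
    e ∈ near G f :=
  mem_near.2 ⟨he, hfe.symm, edgesNear_symm (h.edgesNear hv hve hf)⟩

/-- Complete a coloring of the edges off a four-cycle, some of whose spokes repeat colors. -/
lemma finish (h : FourCycle G w x y z) (hd : ∀ v, (nbrs G v).card = 5)
    {c : Sym2 V → Fin 37} {S R : Finset (Sym2 V)} {f₀ : Sym2 V} (hp : ProperOn G c S)
    (hf₀ : f₀ ∈ cyc w x y z) (hSF : Disjoint S (cyc w x y z))
    (hout : ∀ e, (∀ b ∈ ({w, x, y, z} : Finset V), b ∉ e) → e ∈ S) (hRS : R ⊆ S)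
    (hRE : ∀ r ∈ R, r ∈ G.edgeSet ∧ ∃ b ∈ ({w, x, y, z} : Finset V), b ∈ r)
    (hR : ∀ r ∈ R, ∃ s ∈ S, s ∉ R ∧ c s = c r ∧ s ∈ G.edgeSet ∧
      ∃ b ∈ ({w, x, y, z} : Finset V), b ∈ s)
    (hcard : ∀ f ∈ cyc w x y z, (near G f).card ≤ 37 + R.card)
    (hlast : ∀ c' : Sym2 V → Fin 37, (∀ f ∈ S, c' f = c f) →
      ((near G f₀).image c').card ≤ 36) :
    ∃ c' : Sym2 V → Fin 37, ProperOn G c' univ := by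
  have hne : ∀ f ∈ cyc w x y z, ∀ s ∈ S, f ≠ s := by
    rintro f hf s hs rfl
    exact Finset.disjoint_left.1 hSF hs hf
  refine hp.finish hf₀ hSF ?_ ?_ hRS ?_ ?_ hcard hlast
  · intro e he heS heF
    have : ∃ b ∈ ({w, x, y, z} : Finset V), b ∈ e := by
      by_contra! hb
      exact heS (hout e hb)
    obtain ⟨b, hb, hbe⟩ := this
    refine ⟨fun f hf => h.cyc_mem_near hb hbe hf fun hfe => heF (hfe ▸ hf), ?_⟩
    rw [h.card_cyc]
    exact card_near_le hd he
  · intro f hf hff₀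
    obtain ⟨b, hb, hbf⟩ := exists_mem_of_mem_cyc hf
    exact h.cyc_mem_near hb hbf hf₀ hff₀.symm
  · intro f hf r hr
    obtain ⟨hrE, b, hb, hbr⟩ := hRE r hr
    exact h.mem_near_cyc hb hrE hbr hf (hne f hf r (hRS hr))
  · intro r hr
    obtain ⟨s, hs, hsR, hcs, hsE, b, hb, hbs⟩ := hR r hr
    exact ⟨s, hs, hsR, hcs, fun f hf => h.mem_near_cyc hb hsE hbs hf (hne f hf s hs)⟩

lemma card_near_add_le (h : FourCycle G w x y z) (hd : ∀ v, (nbrs G v).card = 5)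
    {f : Sym2 V} (hf : f ∈ cyc w x y z) :
    (near G f).card + (nbrs G w ∩ nbrs G y).card ≤ 41 := by
  simp only [cyc, mem_insert, mem_singleton] at hf
  rcases hf with rfl | rfl | rfl | rfl
  · exact card_near_add_codegree_le hd h.wx h.xy h.wy
  · rw [Sym2.eq_swap, inter_comm]
    exact card_near_add_codegree_le hd h.xy.symm h.wx.symm h.wy.symm
  · rw [inter_comm]
    exact card_near_add_codegree_le hd h.yz h.zw h.wy.symm
  · rw [Sym2.eq_swap]
    exact card_near_add_codegree_le hd h.zw.symm h.yz.symm h.wy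

/-- A coloring exists if some spokes of a four-cycle can be precolored with enough repetition. -/
lemma exists_coloring_of_precolored (h : FourCycle G w x y z) (hconn : G.Connected)
    (hd : ∀ v, (nbrs G v).card = 5) {M R : Finset (Sym2 V)} {c₀ : Sym2 V → Fin 37}
    (hM : ProperOn G c₀ M) (hM1 : ∀ e ∈ M, ∀ f ∈ M, ∀ b, b ∈ e → b ∈ f → e = f)
    (hME : ∀ e ∈ M, e ∈ G.edgeSet ∧ ∃ b ∈ ({w, x, y, z} : Finset V), b ∈ e)
    (hMF : Disjoint M (cyc w x y z)) (hRM : R ⊆ M)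
    (hR : ∀ r ∈ R, ∃ s ∈ M, s ∉ R ∧ c₀ s = c₀ r)
    (hcard : ∀ f ∈ cyc w x y z, (near G f).card ≤ 36 + R.card) :
    ∃ c : Sym2 V → Fin 37, ProperOn G c univ := by
  obtain ⟨c, hc, hp⟩ := exists_outer hconn hd hM hM1 {w, x, y, z} ⟨w, by simp⟩
  have hf₀ : s(w, x) ∈ cyc w x y z := by simp [cyc]
  have hSF : Disjoint (M ∪ univ.filter fun e => ∀ b ∈ ({w, x, y, z} : Finset V), b ∉ e)
      (cyc w x y z) := by
    rw [disjoint_union_left]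
    refine ⟨hMF, Finset.disjoint_left.2 fun e he he' => ?_⟩
    obtain ⟨b, hb, hbe⟩ := exists_mem_of_mem_cyc he'
    exact (mem_filter.1 he).2 b hb hbe
  have hR' : ∀ r ∈ R, ∃ s ∈ M, s ∉ R ∧ c s = c r := by
    intro r hr
    obtain ⟨s, hs, hsR, hcs⟩ := hR r hr
    exact ⟨s, hs, hsR, by rw [hc s hs, hc r (hRM hr), hcs]⟩
  refine h.finish hd hp hf₀ hSF (fun e he => mem_union_right _ (by simpa using he))
    (hRM.trans subset_union_left) (fun r hr => hME r (hRM hr)) ?_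
    (fun f hf => (hcard f hf).trans (by omega)) ?_
  · intro r hr
    obtain ⟨s, hs, hsR, hcs⟩ := hR' r hr
    exact ⟨s, mem_union_left _ hs, hsR, hcs, hME s hs⟩
  · intro c' hc'
    have hMn : ∀ r ∈ M, r ∈ near G s(w, x) := by
      intro r hr
      obtain ⟨hrE, b, hb, hbr⟩ := hME r hr
      refine h.mem_near_cyc hb hrE hbr hf₀ ?_
      rintro rfl
      exact Finset.disjoint_left.1 hMF hr hf₀
    have h1 := card_image_add_card_le (N := near G s(w, x)) (R := R) (c := c')
      (fun r hr => hMn r (hRM hr)) (fun r hr => by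
        obtain ⟨s, hs, hsR, hcs⟩ := hR' r hr
        exact ⟨s, hMn s hs, hsR, by
          rw [hc' s (mem_union_left _ hs), hc' r (mem_union_left _ (hRM hr)), hcs]⟩)
    have := hcard _ hf₀
    omega

lemma exists_coloring_of_card_near_le (h : FourCycle G w x y z) (hconn : G.Connected)
    (hd : ∀ v, (nbrs G v).card = 5) (hcard : ∀ f ∈ cyc w x y z, (near G f).card ≤ 36) :
    ∃ c : Sym2 V → Fin 37, ProperOn G c univ :=
  h.exists_coloring_of_precolored hconn hd (M := ∅) (R := ∅) (c₀ := fun _ => 0)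
    (by simp [ProperOn]) (by simp) (by simp) (by simp) (by simp) (by simp) (by simpa using hcard)

lemma exists_coloring_of_four_le_codegree (h : FourCycle G w x y z) (hconn : G.Connected)
    (hd : ∀ v, (nbrs G v).card = 5) (hcod : 4 ≤ (nbrs G w ∩ nbrs G y).card) {p r : V}
    (hxp : G.Adj x p) (hpw : p ≠ w) (hpy : p ≠ y) (hzr : G.Adj z r) (hrw : r ≠ w)
    (hry : r ≠ y) (hn : ¬ EdgesNear G s(x, p) s(z, r)) :
    ∃ c : Sym2 V → Fin 37, ProperOn G c univ := by
  have hn' : ¬ EdgesNear G s(z, r) s(x, p) := fun h => hn (edgesNear_symm h)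
  have hne : s(z, r) ≠ s(x, p) := by
    intro he
    exact hn (he ▸ Or.inl ⟨z, by simp⟩)
  refine h.exists_coloring_of_precolored hconn hd (M := {s(x, p), s(z, r)})
    (R := {s(x, p)}) (c₀ := fun _ => 0) ?_ ?_ ?_ ?_ (by simp) ?_ ?_
  · intro e he f hf _ _ hef hnear
    grind
  · intro e he f hf b hbe hbf
    have := fun h => hn (Or.inl h)
    grind
  · intro e he
    simp only [mem_insert, mem_singleton] at he ⊢
    rcases he with rfl | rfl
    exacts [⟨hxp, x, by simp⟩, ⟨hzr, z, by simp⟩]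
  · have h1 := h.wx.ne
    have h2 := h.xy.ne
    have h3 := h.yz.ne
    have h4 := h.zw.ne
    have h5 := h.wy
    have h6 := h.xz
    rw [Finset.disjoint_left]
    intro e he he'
    simp only [cyc, mem_insert, mem_singleton] at he he'
    grind [Sym2.eq_iff]
  · intro r hr
    rw [mem_singleton] at hr
    subst hr
    exact ⟨s(z, r), by simp, by simpa using hne, rfl⟩
  · intro f hf
    have := h.card_near_add_le hd hf
    rw [card_singleton]
    omega

lemma card_biUnion_inc_le (h : FourCycle G w x y z) (hd : ∀ v, (nbrs G v).card = 5) :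
    (({w, x, y, z} : Finset V).biUnion (inc G)).card ≤ 16 := by
  have hsub : ({w, x, y, z} : Finset V).biUnion (inc G) ⊆ inc G w ∪ ((inc G x).erase s(w, x) ∪
      ((inc G y).erase s(x, y) ∪ ((inc G z).erase s(y, z)).erase s(z, w))) := by
    intro e he
    simp only [mem_biUnion, mem_insert, mem_singleton, exists_eq_or_imp, exists_eq_left] at he
    simp only [mem_union, mem_erase]
    by_cases hw : e ∈ inc G w
    · exact Or.inl hw
    by_cases hx : e ∈ inc G x
    · refine Or.inr (Or.inl ⟨?_, hx⟩)
      rintro rfl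
      exact hw (mem_inc.2 ⟨h.wx, by simp⟩)
    by_cases hy : e ∈ inc G y
    · refine Or.inr (Or.inr (Or.inl ⟨?_, hy⟩))
      rintro rfl
      exact hx (mem_inc.2 ⟨h.xy, by simp⟩)
    refine Or.inr (Or.inr (Or.inr ⟨?_, ?_, by tauto⟩))
    · rintro rfl
      exact hw (mem_inc.2 ⟨h.zw, by simp⟩)
    · rintro rfl
      exact hy (mem_inc.2 ⟨h.yz, by simp⟩)
  have h1 : ((inc G x).erase s(w, x)).card = 4 := by
    rw [card_erase_of_mem (mem_inc.2 ⟨h.wx, by simp⟩), card_inc, hd]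
  have h2 : ((inc G y).erase s(x, y)).card = 4 := by
    rw [card_erase_of_mem (mem_inc.2 ⟨h.xy, by simp⟩), card_inc, hd]
  have h3 : (((inc G z).erase s(y, z)).erase s(z, w)).card = 3 := by
    rw [card_erase_of_mem, card_erase_of_mem (mem_inc.2 ⟨h.yz, by simp⟩), card_inc, hd]
    refine mem_erase.2 ⟨?_, mem_inc.2 ⟨h.zw, by simp⟩⟩
    have h1 := h.wy
    have h2 := h.yz.ne
    grind [Sym2.eq_iff]
  have h4 : (inc G w).card = 5 := by rw [card_inc, hd]
  have h5 := (card_le_card hsub).trans (card_union_le _ _)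
  have h6 := card_union_le ((inc G x).erase s(w, x))
    ((inc G y).erase s(x, y) ∪ ((inc G z).erase s(y, z)).erase s(z, w))
  have h7 := card_union_le ((inc G y).erase s(x, y)) (((inc G z).erase s(y, z)).erase s(z, w))
  omega

end FourCycle

lemma card_near_inter_le (hd : ∀ v, (nbrs G v).card = 5) {w x y p₁ p₂ : V} (hxw : G.Adj x w)
    (hxy : G.Adj x y) (hwy : w ≠ y) (hxp₁ : G.Adj x p₁) (hxp₂ : G.Adj x p₂) (hp : p₁ ≠ p₂)
    (hp₁w : p₁ ≠ w) (hp₁y : p₁ ≠ y) (hp₂w : p₂ ≠ w) (hp₂y : p₂ ≠ y)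
    {M S : Finset (Sym2 V)} (hM1 : ∀ e ∈ M, ∀ f ∈ M, ∀ b, b ∈ e → b ∈ f → e = f)
    (hS : ∀ e ∈ S, e ∈ M ∨ w ∉ e ∧ x ∉ e ∧ y ∉ e) {e₂ : Sym2 V} (he₁ : s(x, p₁) ∈ M)
    (he₂ : e₂ ∈ M) (hwe₂ : w ∉ e₂) (hye₂ : y ∉ e₂) (hne : s(x, p₁) ≠ e₂) :
    (near G s(x, p₂) ∩ S).card ≤ 27 + M.card := by
  obtain ⟨p₃, hp₃⟩ : ∃ p₃, ((((nbrs G x).erase w).erase y).erase p₁).erase p₂ = {p₃} := by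
    rw [← card_eq_one]
    rw [card_erase_of_mem, card_erase_of_mem, card_erase_of_mem, card_erase_of_mem, hd] <;>
      simp [*, hwy.symm, hp.symm]
  have hmem : ∀ u, u ∈ ((((nbrs G x).erase w).erase y).erase p₁).erase p₂ ↔ u = p₃ := by
    simp [hp₃]
  simp only [mem_erase, mem_nbrs] at hmem
  obtain ⟨h32, h31, h3y, h3w, h3x⟩ := (hmem p₃).2 rfl
  have hsub : near G s(x, p₂) ∩ S ⊆ (M \ {s(x, p₁), e₂}) ∪ (inc G p₁ ∪
      ((inc G p₃).erase s(x, p₃) ∪ ((nbrs G p₂).erase x).biUnion (inc G))) := by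
    intro f hf
    obtain ⟨hfn, hfS⟩ := mem_inter.1 hf
    obtain ⟨u, hu, hfu⟩ := mem_biUnion.1 (near_subset hfn)
    rcases mem_union.1 hu with hu | hu
    · simp only [mem_erase, mem_nbrs] at hu
      have huf := (mem_inc.1 hfu).2
      by_cases hw : w ∈ f
      · refine mem_union_left _ (mem_sdiff.2 ⟨by have := hS f hfS; tauto, ?_⟩)
        simp only [mem_insert, mem_singleton, not_or]
        refine ⟨?_, fun h => hwe₂ (h ▸ hw)⟩
        rintro rfl
        simp [hxw.ne', hp₁w.symm] at hw
      by_cases hy : y ∈ f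
      · refine mem_union_left _ (mem_sdiff.2 ⟨by have := hS f hfS; tauto, ?_⟩)
        simp only [mem_insert, mem_singleton, not_or]
        refine ⟨?_, fun h => hye₂ (h ▸ hy)⟩
        rintro rfl
        simp [hxy.ne', hp₁y.symm] at hy
      by_cases hu1 : u = p₁
      · exact mem_union_right _ (mem_union_left _ (hu1 ▸ hfu))
      have hu3 : u = p₃ := (hmem u).1 ⟨hu.1, hu1, fun h => hy (h ▸ huf), fun h => hw (h ▸ huf), hu.2⟩
      subst hu3
      refine mem_union_right _ (mem_union_right _ (mem_union_left _ (mem_erase.2 ⟨?_, hfu⟩)))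
      rintro rfl
      have hfM : s(x, u) ∈ M := by
        have := hS _ hfS
        simpa using this
      exact h31 (Sym2.congr_right.1 (hM1 _ hfM _ he₁ x (by simp) (by simp)))
    · exact mem_union_right _ (mem_union_right _ (mem_union_right _ (mem_biUnion.2 ⟨u, hu, hfu⟩)))
  have h1 : (M \ {s(x, p₁), e₂}).card = M.card - 2 := by
    rw [card_sdiff_of_subset (by simp [insert_subset_iff, he₁, he₂]), card_pair hne]
  have h1' : 2 ≤ M.card := by
    rw [← card_pair hne]
    exact card_le_card (by simp [insert_subset_iff, he₁, he₂])
  have h2 : (inc G p₁).card = 5 := by rw [card_inc, hd]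
  have h3 : ((inc G p₃).erase s(x, p₃)).card = 4 := by
    rw [card_erase_of_mem (mem_inc.2 ⟨h3x, by simp⟩), card_inc, hd]
  have h4 := card_biUnion_le_card_mul ((nbrs G p₂).erase x) (inc G) 5
    fun v _ => by rw [card_inc, hd]
  rw [card_erase_of_mem (by simpa using hxp₂.symm), hd] at h4
  have h5 := (card_le_card hsub).trans (card_union_le _ _)
  have h6 := card_union_le (inc G p₁)
    ((inc G p₃).erase s(x, p₃) ∪ ((nbrs G p₂).erase x).biUnion (inc G))
  have h7 := card_union_le ((inc G p₃).erase s(x, p₃)) (((nbrs G p₂).erase x).biUnion (inc G))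
  omega

namespace FourCycle

variable {w x y z : V}

/-- As `exists_coloring_of_precolored`, with one repetition fewer but another pair of spokes that
are not near each other. -/
lemma exists_coloring_of_precolored_of_not_near (h : FourCycle G w x y z) (hconn : G.Connected)
    (hd : ∀ v, (nbrs G v).card = 5) {M R : Finset (Sym2 V)} {c₀ : Sym2 V → Fin 37}
    (hM : ProperOn G c₀ M) (hM1 : ∀ e ∈ M, ∀ f ∈ M, ∀ b, b ∈ e → b ∈ f → e = f)
    (hME : ∀ e ∈ M, e ∈ G.edgeSet ∧ ∃ b ∈ ({w, x, y, z} : Finset V), b ∈ e)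
    (hMF : Disjoint M (cyc w x y z)) (hM4 : M.card ≤ 4) (hRM : R ⊆ M)
    (hR : ∀ r ∈ R, ∃ s ∈ M, s ∉ R ∧ c₀ s = c₀ r)
    (hcard : ∀ f ∈ cyc w x y z, (near G f).card ≤ 37 + R.card)
    {p₁ p₂ r₁ r₂ : V} (hxp₁ : G.Adj x p₁) (hxp₂ : G.Adj x p₂) (hp : p₁ ≠ p₂)
    (hp₁w : p₁ ≠ w) (hp₁y : p₁ ≠ y) (hp₂w : p₂ ≠ w) (hp₂y : p₂ ≠ y)
    (hzr₁ : G.Adj z r₁) (hzr₂ : G.Adj z r₂) (hr : r₁ ≠ r₂)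
    (hr₁w : r₁ ≠ w) (hr₁y : r₁ ≠ y) (hr₂w : r₂ ≠ w) (hr₂y : r₂ ≠ y)
    (hpM : s(x, p₁) ∈ M) (hrM : s(z, r₁) ∈ M) (hne : s(x, p₁) ≠ s(z, r₁))
    (hn : ¬ EdgesNear G s(x, p₂) s(z, r₂)) :
    ∃ c : Sym2 V → Fin 37, ProperOn G c univ := by
  obtain ⟨c, hc, hp'⟩ := exists_outer hconn hd hM hM1 {w, x, y, z} ⟨w, by simp⟩
  set S₀ := M ∪ univ.filter fun e => ∀ b ∈ ({w, x, y, z} : Finset V), b ∉ e with hS₀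
  have hf₀ : s(w, x) ∈ cyc w x y z := by simp [cyc]
  have hSF : Disjoint S₀ (cyc w x y z) := by
    rw [hS₀, disjoint_union_left]
    refine ⟨hMF, Finset.disjoint_left.2 fun e he he' => ?_⟩
    obtain ⟨b, hb, hbe⟩ := exists_mem_of_mem_cyc he'
    exact (mem_filter.1 he).2 b hb hbe
  have hS₀M : ∀ e ∈ S₀, e ∈ M ∨ w ∉ e ∧ x ∉ e ∧ y ∉ e ∧ z ∉ e := by
    intro e he
    rw [hS₀, mem_union, mem_filter] at he
    refine he.imp id fun he => ?_
    simpa using he.2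
  have hR' : ∀ r ∈ R, ∃ s ∈ M, s ∉ R ∧ c s = c r := by
    intro r hr
    obtain ⟨s, hs, hsR, hcs⟩ := hR r hr
    exact ⟨s, hs, hsR, by rw [hc s hs, hc r (hRM hr), hcs]⟩
  have hMS : M ⊆ S₀ := subset_union_left
  have hfin : ∀ (S : Finset (Sym2 V)) (c₁ : Sym2 V → Fin 37), S₀ ⊆ S → ProperOn G c₁ S →
      Disjoint S (cyc w x y z) → (∀ f ∈ S₀, c₁ f = c f) →
      (∀ c' : Sym2 V → Fin 37, (∀ f ∈ S, c' f = c₁ f) →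
        ((near G s(w, x)).image c').card ≤ 36) →
      ∃ c : Sym2 V → Fin 37, ProperOn G c univ := by
    intro S c₁ hSS hp₁ hdis hc₁ hlast
    refine h.finish hd hp₁ hf₀ hdis
      (fun e he => hSS (mem_union_right _ (by simpa using he)))
      (hRM.trans (hMS.trans hSS)) (fun r hr => hME r (hRM hr)) ?_ hcard hlast
    intro r hr
    obtain ⟨s, hs, hsR, hcs⟩ := hR' r hr
    exact ⟨s, hSS (hMS hs), hsR, by rw [hc₁ s (hMS hs), hc₁ r (hMS (hRM hr)), hcs], hME s hs⟩
  have hMn : ∀ r ∈ M, r ∈ near G s(w, x) := by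
    intro r hr
    obtain ⟨hrE, b, hb, hbr⟩ := hME r hr
    refine h.mem_near_cyc hb hrE hbr hf₀ ?_
    rintro rfl
    exact Finset.disjoint_left.1 hMF hr hf₀
  set I := (near G s(w, x) ∩ S₀).image c with hI
  set U := near G s(w, x) \ S₀ with hU
  have hIU : I.card + U.card ≤ 37 := by
    have h1 := card_image_add_card_le (N := near G s(w, x) ∩ S₀) (R := R) (c := c)
      (fun r hr => mem_inter.2 ⟨hMn r (hRM hr), hMS (hRM hr)⟩) (fun r hr => by
        obtain ⟨s, hs, hsR, hcs⟩ := hR' r hr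
        exact ⟨s, mem_inter.2 ⟨hMn s hs, hMS hs⟩, hsR, hcs⟩)
    have h2 := card_inter_add_card_sdiff (near G s(w, x)) S₀
    have h3 := hcard _ hf₀
    rw [← hI] at h1
    rw [← hU] at h2
    omega
  have himg : ∀ c' : Sym2 V → Fin 37, (∀ f ∈ S₀, c' f = c f) →
      (near G s(w, x)).image c' ⊆ I ∪ U.image c' := by
    intro c' hc' k hk
    obtain ⟨e, he, rfl⟩ := mem_image.1 hk
    by_cases heS : e ∈ S₀
    · rw [hc' e heS]
      exact mem_union_left _ (mem_image_of_mem _ (mem_inter.2 ⟨he, heS⟩))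
    · exact mem_union_right _ (mem_image_of_mem _ (mem_sdiff.2 ⟨he, heS⟩))
  have hwx := h.wx.ne
  have hxy := h.xy.ne
  have hyz := h.yz.ne
  have hzw := h.zw.ne
  have hwy := h.wy
  have hxz := h.xz
  have hsS : s(x, p₂) ∉ S₀ := by
    intro hs
    rcases hS₀M _ hs with hs | hs
    · exact hp (Sym2.congr_right.1 (hM1 _ hpM _ hs x (by simp) (by simp)))
    · simp at hs
  have hsS' : s(z, r₂) ∉ S₀ := by
    intro hs
    rcases hS₀M _ hs with hs | hs
    · exact hr (Sym2.congr_right.1 (hM1 _ hrM _ hs z (by simp) (by simp)))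
    · simp at hs
  have hsF : s(x, p₂) ∉ cyc w x y z := by
    simp only [cyc, mem_insert, mem_singleton]
    grind [Sym2.eq_iff]
  have hsF' : s(z, r₂) ∉ cyc w x y z := by
    simp only [cyc, mem_insert, mem_singleton]
    grind [Sym2.eq_iff]
  have hsU : s(x, p₂) ∈ U := mem_sdiff.2 ⟨h.mem_near_cyc (v := x) (by simp) hxp₂ (by simp) hf₀
    fun h => hsF (h ▸ hf₀), hsS⟩
  have hsU' : s(z, r₂) ∈ U := mem_sdiff.2 ⟨h.mem_near_cyc (v := z) (by simp) hzr₂ (by simp) hf₀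
    fun h => hsF' (h ▸ hf₀), hsS'⟩
  have hsne : s(x, p₂) ≠ s(z, r₂) := fun he => hn (Or.inl ⟨z, by simp [he], by simp⟩)
  have hone : ∀ t ∈ U, t ∉ cyc w x y z → ∀ k ∈ I, k ∉ (near G t ∩ S₀).image c →
      ∃ c : Sym2 V → Fin 37, ProperOn G c univ := by
    intro t htU htF k hkI hk
    have htS := (mem_sdiff.1 htU).2
    have hne : ∀ f ∈ S₀, f ≠ t := fun f hf hft => htS (hft ▸ hf)
    refine hfin (insert t S₀) (Function.update c t k) (subset_insert _ _) (hp'.update htS hk)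
      (disjoint_insert_left.2 ⟨htF, hSF⟩) (fun f hf => Function.update_of_ne (hne f hf) _ _) ?_
    intro c' hc'
    have hc'' : ∀ f ∈ S₀, c' f = c f := fun f hf => by
      rw [hc' f (mem_insert_of_mem hf), Function.update_of_ne (hne f hf)]
    have htk : c' t = k := by rw [hc' t (mem_insert_self _ _), Function.update_self]
    have h1 : I ∪ U.image c' ⊆ I ∪ (U.erase t).image c' := by
      refine union_subset subset_union_left fun j hj => ?_
      obtain ⟨e, he, rfl⟩ := mem_image.1 hj
      by_cases het : e = t
      · rw [het, htk]
        exact mem_union_left _ hkI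
      · exact mem_union_right _ (mem_image_of_mem _ (mem_erase.2 ⟨het, he⟩))
    have h2 := card_le_card ((himg c' hc'').trans h1)
    have h3 := h2.trans (card_union_le _ _)
    have h4 := (card_image_le (s := U.erase t) (f := c'))
    have h5 := card_erase_add_one htU
    omega
  set A := (near G s(x, p₂) ∩ S₀).image c with hA
  set B := (near G s(z, r₂) ∩ S₀).image c with hB
  by_cases hAI : ∃ k ∈ I, k ∉ A
  · obtain ⟨k, hkI, hkA⟩ := hAI
    exact hone _ hsU hsF k hkI hkA
  by_cases hBI : ∃ k ∈ I, k ∉ B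
  · obtain ⟨k, hkI, hkB⟩ := hBI
    exact hone _ hsU' hsF' k hkI hkB
  by_cases hAB : ∃ k, k ∉ A ∧ k ∉ B
  · obtain ⟨k, hkA, hkB⟩ := hAB
    have hne : ∀ f ∈ S₀, f ≠ s(x, p₂) := fun f hf hft => hsS (hft ▸ hf)
    have hne' : ∀ f ∈ S₀, f ≠ s(z, r₂) := fun f hf hft => hsS' (hft ▸ hf)
    have hp₁ := hp'.update hsS hkA
    have hs'i : s(z, r₂) ∉ insert s(x, p₂) S₀ := by simp [hsne.symm, hsS']
    have hp₂ := hp₁.update hs'i (k := k) (by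
      intro hk
      obtain ⟨e, he, hek⟩ := mem_image.1 hk
      obtain ⟨hen, heS⟩ := mem_inter.1 he
      rcases mem_insert.1 heS with rfl | heS
      · exact hn (edgesNear_symm (mem_near.1 hen).2.2)
      · rw [Function.update_of_ne (hne e heS)] at hek
        exact hkB (mem_image.2 ⟨e, mem_inter.2 ⟨hen, heS⟩, hek⟩))
    refine hfin _ _ ((subset_insert _ _).trans (subset_insert _ _)) hp₂
      (disjoint_insert_left.2 ⟨hsF', disjoint_insert_left.2 ⟨hsF, hSF⟩⟩) (fun f hf => by
        rw [Function.update_of_ne (hne' f hf), Function.update_of_ne (hne f hf)]) ?_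
    intro c' hc'
    have h1 := himg c' fun f hf => by
      rw [hc' f (mem_insert_of_mem (mem_insert_of_mem hf)), Function.update_of_ne (hne' f hf),
        Function.update_of_ne (hne f hf)]
    have hk1 : c' s(x, p₂) = k := by
      rw [hc' _ (by simp), Function.update_of_ne hsne, Function.update_self]
    have hk2 : c' s(z, r₂) = k := by rw [hc' _ (by simp), Function.update_self]
    have h2 := card_image_add_card_le (N := U) (R := {s(x, p₂)}) (c := c')
      (by simpa using hsU) (fun e he => by
        rw [mem_singleton] at he
        exact ⟨s(z, r₂), hsU', by simpa using hsne.symm, by rw [he, hk1, hk2]⟩)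
    have h3 := (card_le_card h1).trans (card_union_le _ _)
    rw [card_singleton] at h2
    omega
  push Not at hAI hBI hAB
  refine hfin S₀ c (by simp) hp' hSF (fun _ _ => rfl) fun c' hc' => ?_
  have h1 := (card_le_card (himg c' hc')).trans (card_union_le _ _)
  have h2 := card_image_le (s := U) (f := c')
  have h3 : A.card ≤ 27 + M.card := card_image_le.trans <|
    card_near_inter_le hd h.wx.symm h.xy h.wy hxp₁ hxp₂ hp hp₁w hp₁y hp₂w hp₂y hM1
      (fun e he => by have := hS₀M e he; tauto) hpM hrM (by simp [hzw.symm, hr₁w.symm])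
      (by simp [hyz, hr₁y.symm]) hne
  have h4 : B.card ≤ 27 + M.card := card_image_le.trans <|
    card_near_inter_le hd h.zw h.yz.symm h.wy hzr₁ hzr₂ hr hr₁w hr₁y hr₂w hr₂y hM1
      (fun e he => by have := hS₀M e he; tauto) hrM hpM (by simp [hwx, hp₁w.symm])
      (by simp [hxy.symm, hp₁y.symm]) hne.symm
  have h5 : I.card + (Aᶜ.card + Bᶜ.card) ≤ 37 := by
    have hd1 : Disjoint Aᶜ Bᶜ := by
      rw [Finset.disjoint_left]
      intro k hk hk'
      exact (mem_compl.1 hk') (hAB k (mem_compl.1 hk))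
    have hd2 : Disjoint I (Aᶜ ∪ Bᶜ) := by
      rw [Finset.disjoint_left]
      intro k hk hk'
      rcases mem_union.1 hk' with hk' | hk'
      exacts [mem_compl.1 hk' (hAI k hk), mem_compl.1 hk' (hBI k hk)]
    rw [← card_union_of_disjoint hd1, ← card_union_of_disjoint hd2]
    exact (card_le_univ _).trans (by simp)
  rw [card_compl, card_compl, Fintype.card_fin] at h5
  have h6 : U.card + M.card ≤ 15 := by
    have hsub : insert s(w, x) (U ∪ M) ⊆ ({w, x, y, z} : Finset V).biUnion (inc G) := by
      intro e he
      rcases mem_insert.1 he with rfl | he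
      · exact mem_biUnion.2 ⟨w, by simp, mem_inc.2 ⟨h.wx, by simp⟩⟩
      rcases mem_union.1 he with he | he
      · obtain ⟨hen, heS⟩ := mem_sdiff.1 he
        by_contra hb
        refine heS (mem_union_right _ (mem_filter.2 ⟨mem_univ _, fun b hb' hbe => hb ?_⟩))
        exact mem_biUnion.2 ⟨b, hb', mem_inc.2 ⟨(mem_near.1 hen).1, hbe⟩⟩
      · obtain ⟨heE, b, hb, hbe⟩ := hME e he
        exact mem_biUnion.2 ⟨b, hb, mem_inc.2 ⟨heE, hbe⟩⟩
    have h7 := (card_le_card hsub).trans (h.card_biUnion_inc_le hd)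
    rw [card_insert_of_notMem, card_union_of_disjoint] at h7
    · omega
    · rw [Finset.disjoint_left]
      exact fun e he heM => (mem_sdiff.1 he).2 (hMS heM)
    · rw [mem_union, not_or]
      refine ⟨fun he => ?_, fun he => Finset.disjoint_left.1 hMF he hf₀⟩
      exact (mem_near.1 (mem_sdiff.1 he).1).2.1 rfl
  omega

end FourCycle

/-- If the pairs violating `r` meet the complement of every row and of every column, two of them
differ in both coordinates. -/
lemma exists_two_disjoint_not {α β : Type*} [Nonempty α] {r : α → β → Prop}
    (h1 : ∀ a, ∃ a' b', a' ≠ a ∧ ¬ r a' b') (h2 : ∀ b, ∃ a' b', b' ≠ b ∧ ¬ r a' b') :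
    ∃ a a' b b', a ≠ a' ∧ b ≠ b' ∧ ¬ r a b ∧ ¬ r a' b' := by
  by_contra! H
  obtain ⟨a, b, -, hab⟩ := h1 (Classical.arbitrary α)
  obtain ⟨a', b', ha', hab'⟩ := h1 a
  obtain ⟨a₀, b₀, hb₀, hab₀⟩ := h2 b
  have hb' : b' = b := by
    by_contra hb
    exact hab' (H a a' b b' ha'.symm (Ne.symm hb) hab)
  subst hb'
  by_cases ha : a₀ = a
  · subst ha
    exact hab₀ (H a' a₀ b' b₀ ha' hb₀.symm hab')
  · exact hab₀ (H a a₀ b' b₀ (Ne.symm ha) hb₀.symm hab)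

lemma exists_not_adj_of_card_le (hd : ∀ v, (nbrs G v).card = 5)
    (hcod : ∀ u v, u ≠ v → (nbrs G u ∩ nbrs G v).card ≤ 3) {w x y z : V} (hxz : ¬ G.Adj x z)
    (h : nbrs G x ∩ nbrs G z = {w, y}) (a : V) :
    ∃ a' b', a' ≠ a ∧ a' ∈ nbrs G x \ {w, y} ∧ b' ∈ nbrs G z \ {w, y} ∧ ¬ G.Adj a' b' := by
  by_contra! H
  have hx : ({w, y} : Finset V) ⊆ nbrs G x := h ▸ inter_subset_left
  have hz : ({w, y} : Finset V) ⊆ nbrs G z := h ▸ inter_subset_right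
  have h1 : (nbrs G x \ {w, y}).card ≥ 3 := by
    rw [card_sdiff_of_subset hx, hd]
    have := card_le_two (a := w) (b := y)
    omega
  have h2 : (nbrs G z \ {w, y}).card ≥ 3 := by
    rw [card_sdiff_of_subset hz, hd]
    have := card_le_two (a := w) (b := y)
    omega
  have h3 := pred_card_le_card_erase (s := nbrs G x \ {w, y}) (a := a)
  obtain ⟨a₁, ha₁, a₂, ha₂, hne⟩ := one_lt_card.1
    (show 1 < ((nbrs G x \ {w, y}).erase a).card by omega)
  have h4 : insert x (nbrs G z \ {w, y}) ⊆ nbrs G a₁ ∩ nbrs G a₂ := by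
    rw [mem_erase] at ha₁ ha₂
    intro u hu
    rw [mem_inter, mem_nbrs, mem_nbrs]
    rcases mem_insert.1 hu with rfl | hu
    · exact ⟨(mem_nbrs.1 (mem_sdiff.1 ha₁.2).1).symm, (mem_nbrs.1 (mem_sdiff.1 ha₂.2).1).symm⟩
    · exact ⟨H a₁ u ha₁.1 ha₁.2 hu, H a₂ u ha₂.1 ha₂.2 hu⟩
  have h5 := card_le_card h4
  rw [card_insert_of_notMem fun hx => hxz (mem_nbrs.1 (mem_sdiff.1 hx).1).symm] at h5
  have := hcod a₁ a₂ hne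
  omega

namespace FourCycle

variable {w x y z : V}

/-- Spokes at `x` and `z` that are not near each other, on distinct endpoints. -/
lemma exists_not_near (h : FourCycle G w x y z) (hd : ∀ v, (nbrs G v).card = 5)
    (htf : ∀ a b c, G.Adj a b → G.Adj b c → G.Adj a c → False)
    (hcod : ∀ u v, u ≠ v → (nbrs G u ∩ nbrs G v).card ≤ 3)
    (hxz : nbrs G x ∩ nbrs G z = {w, y}) :
    ∃ p₁ p₂ r₁ r₂, p₁ ≠ p₂ ∧ r₁ ≠ r₂ ∧ (G.Adj x p₁ ∧ p₁ ≠ w ∧ p₁ ≠ y) ∧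
      (G.Adj x p₂ ∧ p₂ ≠ w ∧ p₂ ≠ y) ∧ (G.Adj z r₁ ∧ r₁ ≠ w ∧ r₁ ≠ y) ∧
      (G.Adj z r₂ ∧ r₂ ≠ w ∧ r₂ ≠ y) ∧
      ¬ EdgesNear G s(x, p₁) s(z, r₁) ∧ ¬ EdgesNear G s(x, p₂) s(z, r₂) := by
  have hxz' : ¬ G.Adj x z := fun hz => htf _ _ _ h.wx hz h.zw.symm
  have hzx' : ¬ G.Adj z x := fun hz => hxz' hz.symm
  have hmem : ∀ u, u ∈ nbrs G x → u ∈ nbrs G z → u ∈ ({w, y} : Finset V) :=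
    fun u hx hz => hxz ▸ mem_inter.2 ⟨hx, hz⟩
  have hzx : nbrs G z ∩ nbrs G x = {w, y} := by rw [inter_comm, hxz]
  obtain ⟨a₀, -, -, ha₀, -⟩ := exists_not_adj_of_card_le hd hcod hxz' hxz w
  have : Nonempty {p // p ∈ nbrs G x \ {w, y}} := ⟨⟨a₀, ha₀⟩⟩
  obtain ⟨⟨p₁, hp₁⟩, ⟨p₂, hp₂⟩, ⟨r₁, hr₁⟩, ⟨r₂, hr₂⟩, hp, hr, hn₁, hn₂⟩ :=
    exists_two_disjoint_not (α := {p // p ∈ nbrs G x \ {w, y}})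
      (β := {p // p ∈ nbrs G z \ {w, y}}) (r := fun a b => G.Adj a b)
      (fun a => by
        obtain ⟨a', b', hne, ha', hb', hn⟩ := exists_not_adj_of_card_le hd hcod hxz' hxz a
        exact ⟨⟨a', ha'⟩, ⟨b', hb'⟩, fun h => hne (congrArg Subtype.val h), hn⟩)
      (fun b => by
        obtain ⟨b', a', hne, hb', ha', hn⟩ := exists_not_adj_of_card_le hd hcod hzx' hzx b
        exact ⟨⟨a', ha'⟩, ⟨b', hb'⟩, fun h => hne (congrArg Subtype.val h), fun h => hn h.symm⟩)
  have key : ∀ p r, p ∈ nbrs G x \ {w, y} → r ∈ nbrs G z \ {w, y} → ¬ G.Adj p r →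
      ¬ EdgesNear G s(x, p) s(z, r) := by
    intro p r hp hr hpr
    rw [mem_sdiff] at hp hr
    refine not_edgesNear_of_not_adj (mem_nbrs.1 hp.1) (mem_nbrs.1 hr.1) h.xz hxz' hpr
      (fun hpz => hp.2 (hmem p hp.1 (mem_nbrs.2 hpz.symm)))
      (fun hrx => hr.2 (hmem r (mem_nbrs.2 hrx.symm) hr.1))
  refine ⟨p₁, p₂, r₁, r₂, fun h => hp (Subtype.ext h), fun h => hr (Subtype.ext h), ?_, ?_, ?_, ?_,
    key _ _ hp₁ hr₁ hn₁, key _ _ hp₂ hr₂ hn₂⟩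
  · simpa using hp₁
  · simpa using hp₂
  · simpa using hr₁
  · simpa using hr₂

lemma exists_coloring_of_three_le_codegree (h : FourCycle G w x y z) (hconn : G.Connected)
    (hd : ∀ v, (nbrs G v).card = 5) (hcod : 3 ≤ (nbrs G w ∩ nbrs G y).card)
    {p₁ p₂ r₁ r₂ : V} (hp : p₁ ≠ p₂) (hr : r₁ ≠ r₂) (hp₁ : G.Adj x p₁ ∧ p₁ ≠ w ∧ p₁ ≠ y)
    (hp₂ : G.Adj x p₂ ∧ p₂ ≠ w ∧ p₂ ≠ y) (hr₁ : G.Adj z r₁ ∧ r₁ ≠ w ∧ r₁ ≠ y)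
    (hr₂ : G.Adj z r₂ ∧ r₂ ≠ w ∧ r₂ ≠ y) (hn₁ : ¬ EdgesNear G s(x, p₁) s(z, r₁))
    (hn₂ : ¬ EdgesNear G s(x, p₂) s(z, r₂)) :
    ∃ c : Sym2 V → Fin 37, ProperOn G c univ := by
  have hn' : ¬ EdgesNear G s(z, r₁) s(x, p₁) := fun h => hn₁ (edgesNear_symm h)
  have hne : s(x, p₁) ≠ s(z, r₁) := fun he => hn₁ (Or.inl ⟨z, by simp [he], by simp⟩)
  obtain ⟨hxp₁, hp₁w, hp₁y⟩ := hp₁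
  obtain ⟨hxp₂, hp₂w, hp₂y⟩ := hp₂
  obtain ⟨hzr₁, hr₁w, hr₁y⟩ := hr₁
  obtain ⟨hzr₂, hr₂w, hr₂y⟩ := hr₂
  refine h.exists_coloring_of_precolored_of_not_near hconn hd (M := {s(x, p₁), s(z, r₁)})
    (R := {s(x, p₁)}) (c₀ := fun _ => 0) ?_ ?_ ?_ ?_ (card_le_two.trans (by simp)) (by simp)
    ?_ ?_ hxp₁ hxp₂ hp hp₁w hp₁y hp₂w hp₂y hzr₁ hzr₂ hr hr₁w hr₁y hr₂w hr₂y (by simp) (by simp)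
    hne hn₂
  · intro e he f hf _ _ hef hnear
    grind
  · intro e he f hf b hbe hbf
    have := fun h => hn₁ (Or.inl h)
    grind
  · intro e he
    simp only [mem_insert, mem_singleton] at he ⊢
    rcases he with rfl | rfl
    exacts [⟨hxp₁, x, by simp⟩, ⟨hzr₁, z, by simp⟩]
  · have h1 := h.wx.ne
    have h2 := h.xy.ne
    have h3 := h.yz.ne
    have h4 := h.zw.ne
    have h5 := h.wy
    have h6 := h.xz
    rw [Finset.disjoint_left]
    intro e he he'
    simp only [cyc, mem_insert, mem_singleton] at he he'
    grind [Sym2.eq_iff]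
  · intro r hr
    rw [mem_singleton] at hr
    subst hr
    exact ⟨s(z, r₁), by simp, by simpa using hne.symm, rfl⟩
  · intro f hf
    have := h.card_near_add_le hd hf
    rw [card_singleton]
    omega

lemma exists_coloring_of_two_le_codegree (h : FourCycle G w x y z) (hconn : G.Connected)
    (hd : ∀ v, (nbrs G v).card = 5) (htf : ∀ a b c, G.Adj a b → G.Adj b c → G.Adj a c → False)
    {p₁ p₂ r₁ r₂ a b : V} (hp : p₁ ≠ p₂) (hr : r₁ ≠ r₂) (hp₁ : G.Adj x p₁ ∧ p₁ ≠ w ∧ p₁ ≠ y)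
    (hp₂ : G.Adj x p₂ ∧ p₂ ≠ w ∧ p₂ ≠ y) (hr₁ : G.Adj z r₁ ∧ r₁ ≠ w ∧ r₁ ≠ y)
    (hr₂ : G.Adj z r₂ ∧ r₂ ≠ w ∧ r₂ ≠ y) (hn₁ : ¬ EdgesNear G s(x, p₁) s(z, r₁))
    (hn₂ : ¬ EdgesNear G s(x, p₂) s(z, r₂)) (ha : G.Adj w a ∧ a ≠ x ∧ a ≠ z)
    (hb : G.Adj y b ∧ b ≠ x ∧ b ≠ z) (hn : ¬ EdgesNear G s(w, a) s(y, b)) :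
    ∃ c : Sym2 V → Fin 37, ProperOn G c univ := by
  have hn' : ¬ EdgesNear G s(z, r₁) s(x, p₁) := fun h => hn₁ (edgesNear_symm h)
  have hnn' : ¬ EdgesNear G s(y, b) s(w, a) := fun h => hn (edgesNear_symm h)
  have hne : s(x, p₁) ≠ s(z, r₁) := fun he => hn₁ (Or.inl ⟨z, by simp [he], by simp⟩)
  have hne' : s(w, a) ≠ s(y, b) := fun he => hn (Or.inl ⟨y, by simp [he], by simp⟩)
  have hd₁ := fun h => hn₁ (Or.inl h)
  have hd₂ := fun h => hn (Or.inl h)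
  obtain ⟨hxp₁, hp₁w, hp₁y⟩ := hp₁
  obtain ⟨hxp₂, hp₂w, hp₂y⟩ := hp₂
  obtain ⟨hzr₁, hr₁w, hr₁y⟩ := hr₁
  obtain ⟨hzr₂, hr₂w, hr₂y⟩ := hr₂
  obtain ⟨hwa, hax, haz⟩ := ha
  obtain ⟨hyb, hbx, hbz⟩ := hb
  have h1 := h.wx.ne
  have h2 := h.xy.ne
  have h3 := h.yz.ne
  have h4 := h.zw.ne
  have h5 := h.wy
  have h6 := h.xz
  have hpa : p₁ ≠ a := by rintro rfl; exact htf _ _ _ h.wx hxp₁ hwa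
  have hpb : p₁ ≠ b := by rintro rfl; exact htf _ _ _ h.xy hyb hxp₁
  have hra : r₁ ≠ a := by rintro rfl; exact htf _ _ _ h.zw hwa hzr₁
  have hrb : r₁ ≠ b := by rintro rfl; exact htf _ _ _ h.yz hzr₁ hyb
  have hcod : 2 ≤ (nbrs G w ∩ nbrs G y).card := by
    rw [← card_pair h.xz]
    exact card_le_card (by
      simp [insert_subset_iff, h.wx, h.xy.symm, h.yz, h.zw.symm])
  have hx1 : x ∉ s(w, a) := by simp [h1.symm, hax.symm]
  have hx2 : x ∉ s(y, b) := by simp [h2, hbx.symm]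
  have hz1 : z ∉ s(w, a) := by simp [h4, haz.symm]
  have hz2 : z ∉ s(y, b) := by simp [h3.symm, hbz.symm]
  have hne1 : s(x, p₁) ≠ s(w, a) := fun he => hx1 (he ▸ by simp)
  have hne2 : s(x, p₁) ≠ s(y, b) := fun he => hx2 (he ▸ by simp)
  have hne3 : s(z, r₁) ≠ s(w, a) := fun he => hz1 (he ▸ by simp)
  have hne4 : s(z, r₁) ≠ s(y, b) := fun he => hz2 (he ▸ by simp)
  set c₀ : Sym2 V → Fin 37 := fun e => if x ∈ e ∨ z ∈ e then 0 else 1 with hc₀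
  have hc1 : c₀ s(x, p₁) = 0 := by simp [hc₀]
  have hc2 : c₀ s(z, r₁) = 0 := by simp [hc₀]
  have hc3 : c₀ s(w, a) = 1 := by rw [hc₀]; exact if_neg (by tauto)
  have hc4 : c₀ s(y, b) = 1 := by rw [hc₀]; exact if_neg (by tauto)
  clear_value c₀
  have h01 : (0 : Fin 37) ≠ 1 := by decide
  refine h.exists_coloring_of_precolored_of_not_near hconn hd
    (M := {s(x, p₁), s(z, r₁), s(w, a), s(y, b)})
    (R := {s(x, p₁), s(w, a)}) (c₀ := c₀) ?_ ?_ ?_ ?_ card_le_four (by simp [insert_subset_iff])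
    ?_ ?_ hxp₁ hxp₂ hp hp₁w hp₁y hp₂w hp₂y hzr₁ hzr₂ hr hr₁w hr₁y hr₂w hr₂y (by simp) (by simp)
    hne hn₂
  · intro e he f hf _ _ hef hnear
    simp only [mem_insert, mem_singleton] at he hf
    rcases he with rfl | rfl | rfl | rfl <;> rcases hf with rfl | rfl | rfl | rfl <;> simp_all
  · intro e he f hf v hve hvf
    simp only [mem_insert, mem_singleton] at he hf
    rcases he with rfl | rfl | rfl | rfl <;> rcases hf with rfl | rfl | rfl | rfl <;>
      grind
  · intro e he
    simp only [mem_insert, mem_singleton] at he ⊢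
    rcases he with rfl | rfl | rfl | rfl
    exacts [⟨hxp₁, x, by simp⟩, ⟨hzr₁, z, by simp⟩, ⟨hwa, w, by simp⟩, ⟨hyb, y, by simp⟩]
  · rw [Finset.disjoint_left]
    intro e he he'
    simp only [cyc, mem_insert, mem_singleton] at he he'
    rcases he with rfl | rfl | rfl | rfl <;> grind [Sym2.eq_iff]
  · intro r hr
    simp only [mem_insert, mem_singleton] at hr
    rcases hr with rfl | rfl
    · exact ⟨s(z, r₁), by simp, by simp [hne.symm, hne3], by rw [hc1, hc2]⟩
    · exact ⟨s(y, b), by simp, by simp [hne'.symm, hne2.symm], by rw [hc3, hc4]⟩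
  · intro f hf
    have := h.card_near_add_le hd hf
    rw [card_pair hne1]
    omega

end FourCycle

lemma exists_adj_not_adj (hd : ∀ v, (nbrs G v).card = 5) {x z : V}
    (hcod : (nbrs G x ∩ nbrs G z).card ≤ 4) : ∃ p, G.Adj x p ∧ ¬ G.Adj z p := by
  by_contra! h
  have : nbrs G x ∩ nbrs G z = nbrs G x :=
    inter_eq_left.2 fun u hu => mem_nbrs.2 (h u (mem_nbrs.1 hu))
  rw [this, hd] at hcod
  omega

/-- Among three vertices of a triangle-free graph with pairwise incomparable neighborhoods, two
have nonadjacent private neighbors. -/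
lemma exists_private_not_adj {x z c : V}
    (htf : ∀ a b c, G.Adj a b → G.Adj b c → G.Adj a c → False)
    (hpriv : ∀ u ∈ ({x, z, c} : Finset V), ∀ v ∈ ({x, z, c} : Finset V), u ≠ v →
      ∃ p, G.Adj u p ∧ ¬ G.Adj v p) (hxz : x ≠ z) (hxc : x ≠ c) (hzc : z ≠ c) :
    ∃ u ∈ ({x, z, c} : Finset V), ∃ v ∈ ({x, z, c} : Finset V), u ≠ v ∧
      ∃ p r, G.Adj u p ∧ ¬ G.Adj v p ∧ G.Adj v r ∧ ¬ G.Adj u r ∧ ¬ G.Adj p r := by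
  by_contra! H
  have h1 : ∀ x' z', x' ∈ ({x, z, c} : Finset V) → z' ∈ ({x, z, c} : Finset V) → x' ≠ z' →
      x' ≠ c → z' ≠ c → ∀ p r, G.Adj x' p → ¬ G.Adj z' p → G.Adj z' r → ¬ G.Adj x' r →
      G.Adj p r → G.Adj c p → ¬ G.Adj c r → False := by
    intro x' z' hx' hz' hne hxc' hzc' p r hxp hzp hzr hxr hpr hcp hcr
    have hc' : c ∈ ({x, z, c} : Finset V) := by simp
    obtain ⟨p', hp', hp'c⟩ := hpriv x' hx' c hc' hxc'
    obtain ⟨s, hs, hsx⟩ := hpriv c hc' x' hx' hxc'.symm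
    have h2 := H x' hx' c hc' hxc' p' s hp' hp'c hs hsx
    have h3 : ¬ G.Adj z' p' := fun h =>
      htf _ _ _ hp' (H z' hz' c hc' hzc' p' p h hp'c hcp hzp) hxp
    have h4 : ¬ G.Adj z' s := fun h => htf _ _ _ hcp (H x' hx' z' hz' hne p s hxp hzp h hsx) hs
    exact htf _ _ _ (H x' hx' z' hz' hne p' r hp' h3 hzr hxr)
      (H z' hz' c hc' hzc' r s hzr hcr hs h4) h2
  have hx' : x ∈ ({x, z, c} : Finset V) := by simp
  have hz' : z ∈ ({x, z, c} : Finset V) := by simp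
  have hc' : c ∈ ({x, z, c} : Finset V) := by simp
  obtain ⟨p, hxp, hzp⟩ := hpriv x hx' z hz' hxz
  obtain ⟨r, hzr, hxr⟩ := hpriv z hz' x hx' hxz.symm
  have hpr := H x hx' z hz' hxz p r hxp hzp hzr hxr
  by_cases hcp : G.Adj c p
  · exact h1 x z hx' hz' hxz hxc hzc p r hxp hzp hzr hxr hpr hcp fun hcr => htf _ _ _ hcp hpr hcr
  by_cases hcr : G.Adj c r
  · exact h1 z x hz' hx' hxz.symm hzc hxc r p hzr hxr hxp hzp hpr.symm hcr hcp
  have h2 : ∀ s, G.Adj c s → ¬ G.Adj x s → ¬ G.Adj z s → False := fun s hs hsx hsz =>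
    htf _ _ _ hpr (H z hz' c hc' hzc r s hzr hcr hs hsz) (H x hx' c hc' hxc p s hxp hcp hs hsx)
  obtain ⟨s, hs, hsx⟩ := hpriv c hc' x hx' hxc.symm
  obtain ⟨s', hs', hsz'⟩ := hpriv c hc' z hz' hzc.symm
  have h3 : G.Adj z s := by
    by_contra h
    exact h2 s hs hsx h
  have h4 : G.Adj x s' := by
    by_contra h
    exact h2 s' hs' h hsz'
  exact htf _ _ _ hs' (H x hx' z hz' hxz s' s h4 hsz' h3 hsx) hs

lemma exists_coloring_of_five_le_codegree (hconn : G.Connected)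
    (hd : ∀ v, (nbrs G v).card = 5) {w y : V} (hwy : w ≠ y)
    (h5 : 5 ≤ (nbrs G w ∩ nbrs G y).card) : ∃ c : Sym2 V → Fin 37, ProperOn G c univ := by
  obtain ⟨x, hx, z, hz, hxz⟩ := one_lt_card.1 (show 1 < (nbrs G w ∩ nbrs G y).card by omega)
  simp only [mem_inter, mem_nbrs] at hx hz
  have h : FourCycle G w x y z := ⟨hx.1, hx.2.symm, hz.2, hz.1.symm, hwy, hxz⟩
  refine h.exists_coloring_of_card_near_le hconn hd fun f hf => ?_
  have := h.card_near_add_le hd hf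
  omega

lemma exists_coloring_of_four_le_codegree (hconn : G.Connected)
    (hd : ∀ v, (nbrs G v).card = 5) (htf : ∀ a b c, G.Adj a b → G.Adj b c → G.Adj a c → False)
    (hcod : ∀ u v, u ≠ v → (nbrs G u ∩ nbrs G v).card ≤ 4) {w y : V} (hwy : w ≠ y)
    (h4 : 4 ≤ (nbrs G w ∩ nbrs G y).card) : ∃ c : Sym2 V → Fin 37, ProperOn G c univ := by
  obtain ⟨T, hT, hT3⟩ := exists_subset_card_eq (show 3 ≤ (nbrs G w ∩ nbrs G y).card by omega)
  obtain ⟨a, b, c, hab, hac, hbc, rfl⟩ := card_eq_three.1 hT3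
  obtain ⟨x, hx, z, hz, hxz, p, r, hxp, hzp, hzr, hxr, hpr⟩ := exists_private_not_adj htf
    (fun u _ v _ huv => exists_adj_not_adj hd (hcod u v huv)) hab hac hbc
  obtain ⟨hwx, hyx⟩ := mem_inter.1 (hT hx)
  obtain ⟨hwz, hyz⟩ := mem_inter.1 (hT hz)
  rw [mem_nbrs] at hwx hyx hwz hyz
  have h : FourCycle G w x y z := ⟨hwx, hyx.symm, hyz, hwz.symm, hwy, hxz⟩
  refine h.exists_coloring_of_four_le_codegree hconn hd h4 hxp ?_ ?_ hzr ?_ ?_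
    (not_edgesNear_of_not_adj hxp hzr hxz (fun h => htf _ _ _ hwx h hwz) hpr
      (fun h => hzp h.symm) (fun h => hxr h.symm))
  · rintro rfl
    exact hzp hwz.symm
  · rintro rfl
    exact hzp hyz.symm
  · rintro rfl
    exact hxr hwx.symm
  · rintro rfl
    exact hxr hyx.symm

lemma exists_coloring_of_completeBipartite (hconn : G.Connected)
    (hd : ∀ v, (nbrs G v).card = 5) {w y q x z c : V} (hwy : w ≠ y) (hwq : w ≠ q) (hyq : y ≠ q)
    (hxz : x ≠ z) (hxc : x ≠ c) (hzc : z ≠ c)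
    (h : ∀ u ∈ ({w, y, q} : Finset V), ∀ v ∈ ({x, z, c} : Finset V), G.Adj u v) :
    ∃ c : Sym2 V → Fin 37, ProperOn G c univ := by
  have h3 : ∀ u ∈ ({w, y, q} : Finset V), ∀ v ∈ ({w, y, q} : Finset V),
      3 ≤ (nbrs G u ∩ nbrs G v).card := by
    intro u hu v hv
    rw [← card_eq_three.2 ⟨x, z, c, hxz, hxc, hzc, rfl⟩]
    exact card_le_card fun t ht => mem_inter.2
      ⟨mem_nbrs.2 (h u hu t ht), mem_nbrs.2 (h v hv t ht)⟩
  have hw : w ∈ ({w, y, q} : Finset V) := by simp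
  have hy : y ∈ ({w, y, q} : Finset V) := by simp
  have hq : q ∈ ({w, y, q} : Finset V) := by simp
  have hx : x ∈ ({x, z, c} : Finset V) := by simp
  have hz : z ∈ ({x, z, c} : Finset V) := by simp
  have hcyc : FourCycle G w x y z :=
    ⟨h w hw x hx, (h y hy x hx).symm, h y hy z hz, (h w hw z hz).symm, hwy, hxz⟩
  have h1 : ∀ v ∈ ({x, z, c} : Finset V), (near G s(w, v)).card ≤ 36 := by
    intro v hv
    have := card_near_add_codegree_add_codegree_le hd (h w hw v hv) (h y hy v hv).symm hwy
      (h q hq v hv).symm hwq hyq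
    have := h3 w hw y hy
    have := h3 w hw q hq
    omega
  have h2 : ∀ v ∈ ({x, z, c} : Finset V), (near G s(y, v)).card ≤ 36 := by
    intro v hv
    have := card_near_add_codegree_add_codegree_le hd (h y hy v hv) (h w hw v hv).symm hwy.symm
      (h q hq v hv).symm hyq hwq
    have := h3 y hy w hw
    have := h3 y hy q hq
    omega
  refine hcyc.exists_coloring_of_card_near_le hconn hd fun f hf => ?_
  simp only [cyc, mem_insert, mem_singleton] at hf
  rcases hf with rfl | rfl | rfl | rfl
  · exact h1 x hx
  · rw [Sym2.eq_swap]
    exact h2 x hx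
  · exact h2 z hz
  · rw [Sym2.eq_swap]
    exact h1 z hz

lemma exists_coloring_of_three_le_codegree (hconn : G.Connected)
    (hd : ∀ v, (nbrs G v).card = 5) (htf : ∀ a b c, G.Adj a b → G.Adj b c → G.Adj a c → False)
    (hcod : ∀ u v, u ≠ v → (nbrs G u ∩ nbrs G v).card ≤ 3) {w y : V} (hwy : w ≠ y)
    (h3 : 3 ≤ (nbrs G w ∩ nbrs G y).card) : ∃ c : Sym2 V → Fin 37, ProperOn G c univ := by
  obtain ⟨x, z, c, hxz, hxc, hzc, hT⟩ :=
    card_eq_three.1 (le_antisymm (hcod w y hwy) h3)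
  have hmem : ∀ u ∈ ({x, z, c} : Finset V), G.Adj w u ∧ G.Adj y u := by
    intro u hu
    rw [← hT, mem_inter, mem_nbrs, mem_nbrs] at hu
    exact hu
  have hcyc : ∀ u ∈ ({x, z, c} : Finset V), ∀ v ∈ ({x, z, c} : Finset V), u ≠ v →
      FourCycle G w u y v := fun u hu v hv huv =>
    ⟨(hmem u hu).1, (hmem u hu).2.symm, (hmem v hv).2, (hmem v hv).1.symm, hwy, huv⟩
  by_contra hno
  have hq : ∀ u ∈ ({x, z, c} : Finset V), ∀ v ∈ ({x, z, c} : Finset V), u ≠ v →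
      ∃ q, q ≠ w ∧ q ≠ y ∧ G.Adj u q ∧ G.Adj v q ∧
        ∀ t, G.Adj u t → G.Adj v t → t = w ∨ t = y ∨ t = q := by
    intro u hu v hv huv
    have hsub : ({w, y} : Finset V) ⊆ nbrs G u ∩ nbrs G v := by
      simp [insert_subset_iff, (hmem u hu).1.symm, (hmem u hu).2.symm, (hmem v hv).1.symm,
        (hmem v hv).2.symm]
    by_cases heq : nbrs G u ∩ nbrs G v = {w, y}
    · have h := hcyc u hu v hv huv
      obtain ⟨p₁, p₂, r₁, r₂, hp, hr, hp₁, hp₂, hr₁, hr₂, hn₁, hn₂⟩ :=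
        h.exists_not_near hd htf hcod heq
      exact absurd (h.exists_coloring_of_three_le_codegree hconn hd h3 hp hr hp₁ hp₂ hr₁ hr₂
        hn₁ hn₂) hno
    · have h1 : ((nbrs G u ∩ nbrs G v) \ {w, y}).Nonempty := by
        rw [sdiff_nonempty]
        exact fun h => heq (h.antisymm hsub)
      obtain ⟨q, hq⟩ := h1
      have h2 : ((nbrs G u ∩ nbrs G v) \ {w, y}).card ≤ 1 := by
        rw [card_sdiff_of_subset hsub, card_pair hwy]
        have := hcod u v huv
        omega
      have h4 := hq
      simp only [mem_sdiff, mem_inter, mem_nbrs, mem_insert, mem_singleton, not_or] at h4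
      refine ⟨q, h4.2.1, h4.2.2, h4.1.1, h4.1.2, fun t ht ht' => ?_⟩
      by_contra! hne
      exact hne.2.2 (card_le_one.1 h2 t (by simp [ht, ht', hne]) q hq)
  have hx : x ∈ ({x, z, c} : Finset V) := by simp
  have hz : z ∈ ({x, z, c} : Finset V) := by simp
  have hc : c ∈ ({x, z, c} : Finset V) := by simp
  have hK : ∀ q, q ≠ w → q ≠ y → G.Adj x q → G.Adj z q → G.Adj c q → False := by
    intro q hqw hqy hxq hzq hcq
    refine hno (exists_coloring_of_completeBipartite hconn hd hwy hqw.symm hqy.symm hxz hxc hzc ?_)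
    intro u hu v hv
    simp only [mem_insert, mem_singleton] at hu
    rcases hu with rfl | rfl | rfl
    · exact (hmem v hv).1
    · exact (hmem v hv).2
    · simp only [mem_insert, mem_singleton] at hv
      rcases hv with rfl | rfl | rfl
      exacts [hxq.symm, hzq.symm, hcq.symm]
  obtain ⟨α, hαw, hαy, hxα, hzα, hα⟩ := hq x hx z hz hxz
  obtain ⟨β, hβw, hβy, hxβ, hcβ, hβ⟩ := hq x hx c hc hxc
  obtain ⟨γ, hγw, hγy, hzγ, hcγ, hγ⟩ := hq z hz c hc hzc
  have hcα : ¬ G.Adj c α := hK α hαw hαy hxα hzα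
  have hzβ : ¬ G.Adj z β := fun h => hK β hβw hβy hxβ h hcβ
  have hxγ : ¬ G.Adj x γ := fun h => hK γ hγw hγy h hzγ hcγ
  have hfifth : ∀ u a b, ∃ p, G.Adj u p ∧ p ≠ w ∧ p ≠ y ∧ p ≠ a ∧ p ≠ b := by
    intro u a b
    have h1 : (({w, y, a, b} : Finset V)).card ≤ 4 := card_le_four
    obtain ⟨p, hp, hp'⟩ := exists_mem_notMem_of_card_lt_card
      (show ({w, y, a, b} : Finset V).card < (nbrs G u).card by rw [hd]; omega)
    simp only [mem_insert, mem_singleton, not_or] at hp'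
    exact ⟨p, mem_nbrs.1 hp, hp'⟩
  obtain ⟨p, hxp, hpw, hpy, hpα, hpβ⟩ := hfifth x α β
  obtain ⟨r, hzr, hrw, hry, hrα, hrγ⟩ := hfifth z α γ
  obtain ⟨s, hcs, hsw, hsy, hsβ, hsγ⟩ := hfifth c β γ
  have hzp : ¬ G.Adj z p := fun h => by have := hα p hxp h; tauto
  have hcp : ¬ G.Adj c p := fun h => by have := hβ p hxp h; tauto
  have hxr : ¬ G.Adj x r := fun h => by have := hα r h hzr; tauto
  have hcr : ¬ G.Adj c r := fun h => by have := hγ r hzr h; tauto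
  have hxs : ¬ G.Adj x s := fun h => by have := hβ s h hcs; tauto
  have hzs : ¬ G.Adj z s := fun h => by have := hγ s h hcs; tauto
  have key : ∀ u ∈ ({x, z, c} : Finset V), ∀ v ∈ ({x, z, c} : Finset V), u ≠ v →
      ∀ b g p r, b ≠ p → g ≠ r → (G.Adj u b ∧ b ≠ w ∧ b ≠ y) → (G.Adj u p ∧ p ≠ w ∧ p ≠ y) →
      (G.Adj v g ∧ g ≠ w ∧ g ≠ y) → (G.Adj v r ∧ r ≠ w ∧ r ≠ y) → ¬ G.Adj v b → ¬ G.Adj v p →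
      ¬ G.Adj u g → ¬ G.Adj u r → ¬ G.Adj b g → G.Adj p r := by
    intro u hu v hv huv b g p r hbp hgr hb hp hg hr hvb hvp hug hur hbg
    by_contra hpr
    have huv' : ¬ G.Adj u v := fun h => htf _ _ _ (hmem u hu).1 h (hmem v hv).1
    exact hno ((hcyc u hu v hv huv).exists_coloring_of_three_le_codegree hconn hd h3 hbp hgr hb hp
      hg hr
      (not_edgesNear_of_not_adj hb.1 hg.1 huv huv' hbg (fun h => hvb h.symm) fun h => hug h.symm)
      (not_edgesNear_of_not_adj hp.1 hr.1 huv huv' hpr (fun h => hvp h.symm) fun h => hur h.symm))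
  exact htf p r s
    (key x hx z hz hxz β γ p r hpβ.symm hrγ.symm ⟨hxβ, hβw, hβy⟩ ⟨hxp, hpw, hpy⟩ ⟨hzγ, hγw, hγy⟩
      ⟨hzr, hrw, hry⟩ hzβ hzp hxγ hxr fun h => htf _ _ _ hcβ h hcγ)
    (key z hz c hc hzc α β r s hrα.symm hsβ.symm ⟨hzα, hαw, hαy⟩ ⟨hzr, hrw, hry⟩ ⟨hcβ, hβw, hβy⟩
      ⟨hcs, hsw, hsy⟩ hcα hcr hzβ hzs fun h => htf _ _ _ hxα h hxβ)
    (key x hx c hc hxc α γ p s hpα.symm hsγ.symm ⟨hxα, hαw, hαy⟩ ⟨hxp, hpw, hpy⟩ ⟨hcγ, hγw, hγy⟩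
      ⟨hcs, hsw, hsy⟩ hcα hcp hxγ hxs fun h => htf _ _ _ hzα h hzγ)

lemma exists_coloring_of_two_le_codegree (hconn : G.Connected)
    (hd : ∀ v, (nbrs G v).card = 5) (htf : ∀ a b c, G.Adj a b → G.Adj b c → G.Adj a c → False)
    (hcod : ∀ u v, u ≠ v → (nbrs G u ∩ nbrs G v).card ≤ 2) {w y : V} (hwy : w ≠ y)
    (h2 : 2 ≤ (nbrs G w ∩ nbrs G y).card) : ∃ c : Sym2 V → Fin 37, ProperOn G c univ := by
  obtain ⟨x, z, hxz, hT⟩ := card_eq_two.1 (le_antisymm (hcod w y hwy) h2)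
  have hmem : ∀ u ∈ ({x, z} : Finset V), G.Adj w u ∧ G.Adj y u := by
    intro u hu
    rw [← hT, mem_inter, mem_nbrs, mem_nbrs] at hu
    exact hu
  obtain ⟨hwx, hyx⟩ := hmem x (by simp)
  obtain ⟨hwz, hyz⟩ := hmem z (by simp)
  have h : FourCycle G w x y z := ⟨hwx, hyx.symm, hyz, hwz.symm, hwy, hxz⟩
  have h' : FourCycle G x w z y := ⟨hwx.symm, hwz, hyz.symm, hyx, hxz, hwy⟩
  have hT' : nbrs G x ∩ nbrs G z = {w, y} := by
    refine (eq_of_subset_of_card_le ?_ ?_).symm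
    · simp [insert_subset_iff, hwx.symm, hwz.symm, hyx.symm, hyz.symm]
    · rw [card_pair hwy]
      exact hcod x z hxz
  have hcod' : ∀ u v, u ≠ v → (nbrs G u ∩ nbrs G v).card ≤ 3 :=
    fun u v huv => (hcod u v huv).trans (by omega)
  obtain ⟨p₁, p₂, r₁, r₂, hp, hr, hp₁, hp₂, hr₁, hr₂, hn₁, hn₂⟩ :=
    h.exists_not_near hd htf hcod' hT'
  obtain ⟨a, -, b, -, -, -, ha, -, hb, -, hn, -⟩ := h'.exists_not_near hd htf hcod' hT
  exact h.exists_coloring_of_two_le_codegree hconn hd htf hp hr hp₁ hp₂ hr₁ hr₂ hn₁ hn₂ ha hb hn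

lemma exists_coloring_of_connected (hconn : G.Connected) (hd : ∀ v, (nbrs G v).card = 5) :
    ∃ c : Sym2 V → Fin 37, ProperOn G c univ := by
  by_cases htf : ∀ a b c, G.Adj a b → G.Adj b c → G.Adj a c → False
  · by_contra hno
    have h4 : ∀ u v, u ≠ v → (nbrs G u ∩ nbrs G v).card ≤ 4 := by
      intro u v huv
      by_contra! h
      exact hno (exists_coloring_of_five_le_codegree hconn hd huv h)
    have h3 : ∀ u v, u ≠ v → (nbrs G u ∩ nbrs G v).card ≤ 3 := by
      intro u v huv
      by_contra! h
      exact hno (exists_coloring_of_four_le_codegree hconn hd htf h4 huv h)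
    have h2 : ∀ u v, u ≠ v → (nbrs G u ∩ nbrs G v).card ≤ 2 := by
      intro u v huv
      by_contra! h
      exact hno (exists_coloring_of_three_le_codegree hconn hd htf h3 huv h)
    have h1 : ∀ u v, u ≠ v → (nbrs G u ∩ nbrs G v).card ≤ 1 := by
      intro u v huv
      by_contra! h
      exact hno (exists_coloring_of_two_le_codegree hconn hd htf h2 huv h)
    exact hno (exists_coloring_of_codegree_le_one hconn hd htf h1)
  · push Not at htf
    obtain ⟨x, y, z, hxy, hyz, hxz, -⟩ := htf
    exact exists_coloring_of_triangle hconn hd hxy hyz hxz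

lemma exists_coloring (hd : ∀ v, (nbrs G v).card = 5) :
    ∃ c : Sym2 V → Fin 37, ProperOn G c univ := by
  have hcomp : ∀ C : G.ConnectedComponent, ∃ d : Sym2 C → Fin 37,
      ProperOn C.toSimpleGraph d univ := by
    intro C
    refine exists_coloring_of_connected C.connected_toSimpleGraph fun v => ?_
    rw [← hd v]
    refine card_bij (fun u _ => u.1) ?_ ?_ ?_
    · intro u hu
      rw [mem_nbrs] at hu ⊢
      exact hu
    · exact fun u _ u' _ h => Subtype.ext h
    · intro u hu
      rw [mem_nbrs] at hu
      exact ⟨⟨u, C.mem_supp_of_adj_mem_supp v.2 hu⟩, by rw [mem_nbrs]; exact hu, rfl⟩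
  choose d hdc using hcomp
  have hlift : ∀ e ∈ G.edgeSet, ∀ v ∈ e, ∃ e' : Sym2 (G.connectedComponentMk v),
      e'.map Subtype.val = e := by
    intro e he v hv
    obtain ⟨u, rfl⟩ := Sym2.mem_iff_exists.1 hv
    refine ⟨s(⟨v, rfl⟩, ⟨u, ?_⟩), rfl⟩
    exact (ConnectedComponent.connectedComponentMk_eq_of_adj he).symm
  let c : Sym2 V → Fin 37 := fun e =>
    if he : e ∈ G.edgeSet then
      d (G.connectedComponentMk (Quot.out e).1)
        (hlift e he (Quot.out e).1 (Sym2.out_fst_mem e)).choose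
    else 0
  have hc : ∀ (C : G.ConnectedComponent) (e' : Sym2 C), e'.map Subtype.val ∈ G.edgeSet →
      c (e'.map Subtype.val) = d C e' := by
    intro C e' he
    have h1 := Sym2.out_fst_mem (e'.map (Subtype.val : C → V))
    have hC : G.connectedComponentMk (Quot.out (e'.map (Subtype.val : C → V))).1 = C := by
      obtain ⟨u, -, hu⟩ := Sym2.mem_map.1 h1
      rw [← hu]
      exact u.2
    have h2 := (hlift _ he _ h1).choose_spec
    simp only [c, dif_pos he]
    generalize (hlift _ he _ h1).choose = e'' at h2
    revert e''
    rw [hC]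
    intro e'' h2
    rw [Sym2.map.injective Subtype.val_injective h2]
  refine ⟨c, fun e _ f _ he hf hne hn => ?_⟩
  obtain ⟨C, e', f', rfl, rfl⟩ : ∃ (C : G.ConnectedComponent) (e' f' : Sym2 C),
      e'.map Subtype.val = e ∧ f'.map Subtype.val = f := by
    rcases hn with ⟨x, hx, hy⟩ | ⟨x, y, hx, hy, hxy⟩
    · obtain ⟨e', he'⟩ := hlift e he x hx
      obtain ⟨f', hf'⟩ := hlift f hf x hy
      exact ⟨_, e', f', he', hf'⟩
    · obtain ⟨e', he'⟩ := hlift e he x hx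
      have h := hlift f hf y hy
      rw [← ConnectedComponent.connectedComponentMk_eq_of_adj hxy] at h
      obtain ⟨f', hf'⟩ := h
      exact ⟨_, e', f', he', hf'⟩
  rw [hc C e' he, hc C f' hf]
  have hmap : ∀ t : Sym2 C, t.map Subtype.val ∈ G.edgeSet → t ∈ C.toSimpleGraph.edgeSet := by
    intro t ht
    induction t with | _ a b
    exact ht
  refine hdc C e' (mem_univ _) f' (mem_univ _) (hmap e' he) (hmap f' hf)
    (fun h => hne (by rw [h])) ?_
  simp only [EdgesNear, Sym2.mem_map] at hn
  rcases hn with ⟨x, ⟨a, ha, rfl⟩, b, hb, hab⟩ | ⟨x, y, ⟨a, ha, rfl⟩, ⟨b, hb, rfl⟩, hab⟩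
  · exact Or.inl ⟨a, ha, Subtype.ext hab ▸ hb⟩
  · exact Or.inr ⟨a, b, ha, hb, hab⟩

end

end StrongColoring

/-- If `G` is a 5-regular finite simple graph with girth 3, then `G` has a strong
edge-coloring that uses at most 37 colors. -/
theorem strong_edge_coloring_of_five_regular_girth_three {V : Type*} [Fintype V]
    (G : SimpleGraph V) [DecidableRel G.Adj]
    (hreg : G.IsRegularOfDegree 5) (hgirth : G.egirth = 3) :
    ∃ c : G.edgeSet → Fin 37, IsStrongEdgeColoring G c := by
  obtain ⟨c, hc⟩ := StrongColoring.exists_coloring (G := G) fun v => by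
    rw [← hreg v, ← G.card_neighborFinset_eq_degree]
    congr 1
    ext u
    simp
  exact ⟨fun e => c e, fun e f hef hn => hc e (Finset.mem_univ _) f (Finset.mem_univ _) e.2 f.2
    (fun h => hef (Subtype.ext h)) hn⟩
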